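/- arXiv:math-ph/0509071 — 4 statements merged into one kernel-verified Lean document; each statement's English description precedes it below -/
import Mathlib

section
/- Let Λ ⊂ ℝ^d be a fixed bounded measurable set and let (z_L)_{L>0} ⊂ (0,1) satisfy z_L → 1 as L → ∞. Then sup_{x,y ∈ Λ} | L^{−d} Σ_{k ∈ ℤ^d ∖ {0}} [z_L g_k^{(L)}/(1 − z_L g_k^{(L)})] e^{i 2πk·(x−y)/L} − K(x,y) | → 0 as L → ∞, where K(x,y) = ∫_{ℝ^d} a_1(p;1) e^{i p·(x−y)} dp/(2π)^d. -/
open MeasureTheory Filter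

noncomputable section

/-- the eigenvalue `g_k^{(L)} = exp(-β|2πk/L|²)` of the periodic heat operator. -/
def gk (d : ℕ) (β L : ℝ) (k : Fin d → ℤ) : ℝ :=
  Real.exp (-β * ∑ i, (2 * Real.pi * (k i : ℝ) / L) ^ 2)

/-- `a₁(p;1) = e^{-β|p|²}/(1 - e^{-β|p|²})`. -/
def a1crit (d : ℕ) (β : ℝ) (p : EuclideanSpace ℝ (Fin d)) : ℝ :=
  Real.exp (-β * ‖p‖ ^ 2) / (1 - Real.exp (-β * ‖p‖ ^ 2))

lemma ku_exp_lt {x : ℝ} (hx : x < 0) : Real.exp x < 1 := by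
  simpa using Real.exp_lt_exp.2 hx

lemma ku_exp_bound {t : ℝ} (ht : 0 < t) :
    Real.exp (-t) / (1 - Real.exp (-t)) ≤ t⁻¹ * Real.exp (-(t / 2)) := by
  have h1 : t / 2 ≤ Real.sinh (t / 2) := Real.self_le_sinh_iff.2 (by linarith)
  rw [Real.sinh_eq] at h1
  have hlt : Real.exp (-t) < 1 := ku_exp_lt (by linarith)
  rw [div_le_iff₀ (by linarith), mul_assoc, ← div_eq_inv_mul, le_div_iff₀ ht]
  set a := Real.exp (-(t / 2)) with ha
  have ha0 : 0 < a := Real.exp_pos _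
  have hb : Real.exp (t / 2) * a = 1 := by rw [ha, ← Real.exp_add]; simp
  have hc : Real.exp (-t) = a * a := by rw [ha, ← Real.exp_add]; ring_nf
  rw [hc]
  have h2 : t * a ≤ 1 - a * a := by nlinarith
  nlinarith [mul_le_mul_of_nonneg_right h2 ha0.le]

lemma ku_a1_nonneg (d : ℕ) {β : ℝ} (hβ : 0 < β) (p : EuclideanSpace ℝ (Fin d)) :
    0 ≤ a1crit d β p := by
  unfold a1crit
  have : Real.exp (-β * ‖p‖ ^ 2) ≤ 1 := Real.exp_le_one_iff.2 (by nlinarith [sq_nonneg ‖p‖])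
  exact div_nonneg (Real.exp_pos _).le (by linarith)

lemma ku_a1_integrable (d : ℕ) (hd : 2 < d) {β : ℝ} (hβ : 0 < β) :
    Integrable (a1crit d β) := by
  have : Nontrivial (EuclideanSpace ℝ (Fin d)) := by
    have : Nonempty (Fin d) := ⟨⟨0, by omega⟩⟩
    infer_instance
  have key := (integrable_fun_norm_addHaar (volume : Measure (EuclideanSpace ℝ (Fin d)))
    (f := fun r : ℝ => Real.exp (-β * r ^ 2) / (1 - Real.exp (-β * r ^ 2)))).2
  refine key ?_
  have hint := ((integrable_rpow_mul_exp_neg_mul_sq (b := β / 2) (by positivity)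
    (s := ((d - 3 : ℕ) : ℝ)) (by have := Nat.cast_nonneg (α := ℝ) (d - 3); linarith)).const_mul
      β⁻¹).integrableOn (s := Set.Ioi 0)
  refine Integrable.mono' hint ?_ ?_
  · exact (Measurable.aestronglyMeasurable (by fun_prop))
  · refine (ae_restrict_mem measurableSet_Ioi).mono ?_
    intro r hr
    have hr : 0 < r := hr
    have hb := ku_exp_bound (t := β * r ^ 2) (by positivity)
    have hlt : Real.exp (-(β * r ^ 2)) < 1 := ku_exp_lt (by
      have : 0 < β * r ^ 2 := by positivity
      linarith)
    have h0 : 0 ≤ Real.exp (-(β * r ^ 2)) / (1 - Real.exp (-(β * r ^ 2))) :=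
      div_nonneg (Real.exp_pos _).le (by linarith)
    simp only [neg_mul, finrank_euclideanSpace, Fintype.card_fin, smul_eq_mul, Real.rpow_natCast]
    rw [Real.norm_of_nonneg (by positivity)]
    obtain ⟨m, rfl⟩ : ∃ m, d = m + 3 := ⟨d - 3, by omega⟩
    calc _ ≤ r ^ (m + 3 - 1) * ((β * r ^ 2)⁻¹ * Real.exp (-(β * r ^ 2 / 2))) := by gcongr
      _ = _ := by
        have e1 : m + 3 - 1 = m + 2 := by omega
        have e2 : m + 3 - 3 = m := by omega
        have e3 : -(β * r ^ 2 / 2) = -(β / 2 * r ^ 2) := by ring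
        rw [e1, e2, e3]
        field_simp
        ring

/-- nearest lattice point -/
def kuK (d : ℕ) (h : ℝ) (p : EuclideanSpace ℝ (Fin d)) : Fin d → ℤ :=
  fun i => ⌊p i / h + 1 / 2⌋

lemma kuK_measurable (d : ℕ) (h : ℝ) : Measurable (kuK d h) := by
  unfold kuK
  fun_prop

lemma kuK_close (d : ℕ) {h : ℝ} (hh : 0 < h) (p : EuclideanSpace ℝ (Fin d)) (i : Fin d) :
    |h * (kuK d h p i : ℝ) - p i| ≤ h / 2 := by
  have h1 := Int.floor_le (p i / h + 1 / 2)
  have h2 := Int.lt_floor_add_one (p i / h + 1 / 2)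
  have hp : p i = h * (p i / h) := by field_simp
  unfold kuK
  rw [abs_le]
  constructor <;> nlinarith

lemma kuK_volume (d : ℕ) {h : ℝ} (hh : 0 < h) (k : Fin d → ℤ) :
    (Measure.map (kuK d h) volume).real {k} = h ^ d := by
  rw [Measure.real, Measure.map_apply (kuK_measurable d h) (measurableSet_singleton k)]
  have hs : kuK d h ⁻¹' {k} = (MeasurableEquiv.toLp 2 (Fin d → ℝ)).symm ⁻¹'
      (Set.univ.pi fun i => Set.Ico (h * ((k i : ℝ) - 1 / 2)) (h * ((k i : ℝ) + 1 / 2))) := by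
    ext p
    simp only [Set.mem_preimage, Set.mem_singleton_iff, Set.mem_pi, Set.mem_univ, true_imp_iff,
      Set.mem_Ico, funext_iff, kuK, Int.floor_eq_iff]
    refine forall_congr' fun i => ?_
    change _ ↔ h * ((k i : ℝ) - 1 / 2) ≤ p i ∧ p i < h * ((k i : ℝ) + 1 / 2)
    have hp : p i = h * (p i / h) := by field_simp
    generalize p i / h = q at hp ⊢
    rw [hp, mul_le_mul_iff_right₀ hh, mul_lt_mul_iff_right₀ hh]
    constructor
    · rintro ⟨a, b⟩; constructor <;> linarith
    · rintro ⟨a, b⟩; constructor <;> linarith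
  rw [hs, (EuclideanSpace.volume_preserving_symm_measurableEquiv_toLp (Fin d)).measure_preimage
    (MeasurableSet.univ_pi fun i => measurableSet_Ico).nullMeasurableSet, Real.volume_pi_Ico]
  have : ∀ i, h * ((k i : ℝ) + 1 / 2) - h * ((k i : ℝ) - 1 / 2) = h := fun i => by ring
  simp only [this]
  simp [hh.le]

lemma ku_sum_eq_integral (d : ℕ) {h : ℝ} (hh : 0 < h) (F : (Fin d → ℤ) → ℂ)
    (hF : Integrable (fun p => F (kuK d h p))) :
    ∫ p, F (kuK d h p) = (h : ℂ) ^ d * ∑' k, F k := by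
  have hm : AEStronglyMeasurable F (Measure.map (kuK d h) volume) :=
    (measurable_of_countable F).aestronglyMeasurable
  have hi : Integrable F (Measure.map (kuK d h) volume) :=
    (integrable_map_measure hm (kuK_measurable d h).aemeasurable).2 hF
  rw [← integral_map (kuK_measurable d h).aemeasurable hm, integral_countable hi, ← tsum_mul_left]
  refine tsum_congr fun k => ?_
  rw [kuK_volume d hh]
  simp

/-- lattice coefficient -/
def kuS (d : ℕ) (β L z : ℝ) (k : Fin d → ℤ) : ℝ :=
  if k = 0 then 0 else z * gk d β L k / (1 - z * gk d β L k)

lemma ku_mono {u v : ℝ} (h0 : 0 ≤ u) (huv : u ≤ v) (hv : v < 1) : u / (1 - u) ≤ v / (1 - v) := by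
  rw [div_le_div_iff₀ (by linarith) (by linarith)]
  nlinarith

lemma kuS_bound (d : ℕ) {β L z : ℝ} (hβ : 0 < β) (hL : 0 < L) (hz : z ∈ Set.Ioo (0 : ℝ) 1)
    (p : EuclideanSpace ℝ (Fin d)) :
    |kuS d β L z (kuK d (2 * Real.pi / L) p)| ≤ a1crit d (β / (2 + d / 2)) p := by
  have hβ' : 0 < β / (2 + d / 2 : ℝ) := by positivity
  have hh : 0 < 2 * Real.pi / L := by positivity
  have hclose := kuK_close d hh p
  have hp0 : kuK d (2 * Real.pi / L) p ≠ 0 → p ≠ 0 := by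
    rintro hk rfl
    apply hk
    funext i
    simp only [kuK, PiLp.zero_apply, zero_div, zero_add, Pi.zero_apply, Int.floor_eq_iff]
    norm_num
  generalize kuK d (2 * Real.pi / L) p = k at *
  unfold kuS
  split_ifs with hk
  · simpa using ku_a1_nonneg d hβ' p
  have hp := norm_pos_iff.2 (hp0 hk)
  set h := 2 * Real.pi / L with hdef
  have hs : gk d β L k = Real.exp (-β * ∑ i, (h * k i) ^ 2) := by
    unfold gk
    congr 2
    refine Finset.sum_congr rfl fun i _ => ?_
    rw [hdef]; ring
  set s := ∑ i, (h * (k i : ℝ)) ^ 2 with hsdef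
  have hsh : h ^ 2 ≤ s := by
    obtain ⟨j, hj⟩ := Function.ne_iff.1 hk
    have h1 : (1 : ℝ) ≤ (k j : ℝ) ^ 2 := by
      have : (1 : ℤ) ≤ k j ^ 2 := by
        have : 0 < k j ^ 2 := by
          have : k j ≠ 0 := hj
          positivity
        omega
      exact_mod_cast this
    calc h ^ 2 ≤ (h * (k j : ℝ)) ^ 2 := by rw [mul_pow]; nlinarith [sq_nonneg h]
      _ ≤ s := Finset.single_le_sum (f := fun i => (h * (k i : ℝ)) ^ 2)
        (fun i _ => sq_nonneg _) (Finset.mem_univ j)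
  have hps : ‖p‖ ^ 2 ≤ (2 + d / 2) * s := by
    rw [EuclideanSpace.norm_sq_eq]
    calc ∑ i, ‖p i‖ ^ 2 ≤ ∑ i, (2 * (h * (k i : ℝ)) ^ 2 + h ^ 2 / 2) := by
          refine Finset.sum_le_sum fun i _ => ?_
          have h1 := sq_le_sq' (abs_le.1 (hclose i)).1 (abs_le.1 (hclose i)).2
          rw [Real.norm_eq_abs, sq_abs]
          nlinarith [sq_nonneg (h * (k i : ℝ) - (p i - h * k i))]
      _ = 2 * s + d * (h ^ 2 / 2) := by
          rw [Finset.sum_add_distrib, ← Finset.mul_sum]; simp [hsdef]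
      _ ≤ _ := by nlinarith [Nat.cast_nonneg (α := ℝ) d]
  have hle : gk d β L k ≤ Real.exp (-(β / (2 + d / 2)) * ‖p‖ ^ 2) := by
    rw [hs, Real.exp_le_exp]
    have : β / (2 + d / 2) * ‖p‖ ^ 2 ≤ β * s := by
      rw [div_mul_eq_mul_div, div_le_iff₀ (by positivity)]
      nlinarith
    linarith
  have hlt : Real.exp (-(β / (2 + d / 2)) * ‖p‖ ^ 2) < 1 := ku_exp_lt (by
    have : 0 < β / (2 + d / 2) * ‖p‖ ^ 2 := by positivity
    linarith)
  have hg0 : 0 < gk d β L k := Real.exp_pos _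
  have hzg : z * gk d β L k ≤ gk d β L k := by nlinarith [hz.2]
  have hzg0 : 0 ≤ z * gk d β L k := mul_nonneg hz.1.le hg0.le
  rw [abs_of_nonneg (div_nonneg hzg0 (by linarith))]
  exact ku_mono hzg0 (hzg.trans hle) hlt

lemma kuS_tendsto (d : ℕ) {β : ℝ} (hβ : 0 < β) (zL : ℝ → ℝ)
    (hz1 : Tendsto zL atTop (nhds 1)) (p : EuclideanSpace ℝ (Fin d)) (hp : p ≠ 0) :
    Tendsto (fun L => kuS d β L (zL L) (kuK d (2 * Real.pi / L) p)) atTop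
      (nhds (a1crit d β p)) := by
  have hh : Tendsto (fun L : ℝ => 2 * Real.pi / L) atTop (nhds 0) :=
    tendsto_const_nhds.div_atTop tendsto_id
  have hc : ∀ i, Tendsto (fun L : ℝ => 2 * Real.pi * (kuK d (2 * Real.pi / L) p i : ℝ) / L) atTop
      (nhds (p i)) := by
    intro i
    rw [tendsto_iff_norm_sub_tendsto_zero]
    have h2 : Tendsto (fun L : ℝ => 2 * Real.pi / L / 2) atTop (nhds 0) := by
      simpa using hh.div_const 2
    refine squeeze_zero' (Eventually.of_forall fun L => norm_nonneg _) ?_ h2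
    filter_upwards [eventually_gt_atTop 0] with L hL
    have := kuK_close d (h := 2 * Real.pi / L) (by positivity) p i
    rw [Real.norm_eq_abs]
    convert this using 3
    ring
  have hg : Tendsto (fun L : ℝ => gk d β L (kuK d (2 * Real.pi / L) p)) atTop
      (nhds (Real.exp (-β * ‖p‖ ^ 2))) := by
    rw [EuclideanSpace.norm_sq_eq]
    simp only [Real.norm_eq_abs, sq_abs]
    unfold gk
    exact (Real.continuous_exp.tendsto _).comp
      ((tendsto_finsetSum _ fun i _ => (hc i).pow 2).const_mul (-β))
  have hzg := hz1.mul hg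
  rw [one_mul] at hzg
  have hne : 1 - Real.exp (-β * ‖p‖ ^ 2) ≠ 0 := by
    have hp' := norm_pos_iff.2 hp
    have hlt : Real.exp (-β * ‖p‖ ^ 2) < 1 := ku_exp_lt (by
      have : 0 < β * ‖p‖ ^ 2 := by positivity
      linarith)
    linarith
  have hlim := hzg.div (hzg.const_sub 1) hne
  refine hlim.congr' ?_
  obtain ⟨j, hj⟩ : ∃ j, p j ≠ 0 := by
    by_contra! hcon
    exact hp (by ext i; simpa using hcon i)
  filter_upwards [(hc j).eventually_ne hj] with L hL
  have hk : kuK d (2 * Real.pi / L) p ≠ 0 := by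
    intro h0
    apply hL
    rw [h0]; simp
  simp [kuS, hk]

lemma ku_exp_diff (a b : ℝ) :
    ‖Complex.exp (Complex.I * (a : ℂ)) - Complex.exp (Complex.I * (b : ℂ))‖ ≤ |a - b| := by
  have h1 : Complex.exp (Complex.I * (a : ℂ)) - Complex.exp (Complex.I * (b : ℂ))
      = Complex.exp (Complex.I * (b : ℂ)) * (Complex.exp (Complex.I * ((a - b : ℝ) : ℂ)) - 1) := by
    rw [mul_sub, ← Complex.exp_add]
    push_cast
    ring_nf
  rw [h1, norm_mul, Complex.norm_exp_I_mul_ofReal, one_mul]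
  exact Real.norm_exp_I_mul_ofReal_sub_one_le

/-- Lemma 4(iv): if `z_L → 1`, the kernel of `z_L Q₀G_LQ₀(1-z_L Q₀G_LQ₀)^{-1}`
converges uniformly on any fixed bounded set `Λ` to
`K(x,y) = ∫ a₁(p;1) e^{ip·(x-y)} dp/(2π)^d`. -/
theorem kernel_uniform_convergence (d : ℕ) (hd : 2 < d) (β : ℝ) (hβ : 0 < β)
    (Λ : Set (EuclideanSpace ℝ (Fin d))) (hΛb : Bornology.IsBounded Λ)
    (hΛm : MeasurableSet Λ)
    (zL : ℝ → ℝ) (hz : ∀ L, zL L ∈ Set.Ioo (0 : ℝ) 1)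
    (hz1 : Tendsto zL atTop (nhds 1)) :
    ∀ ε > 0, ∃ L₀ : ℝ, ∀ L : ℝ, L₀ ≤ L → ∀ x ∈ Λ, ∀ y ∈ Λ,
      ‖(∑' k : Fin d → ℤ, if k = 0 then 0 else
            ((zL L * gk d β L k / (1 - zL L * gk d β L k) : ℝ) : ℂ) *
              Complex.exp (Complex.I *
                ((2 * Real.pi * (∑ i, (k i : ℝ) * (x i - y i)) / L : ℝ) : ℂ))) / (L : ℂ) ^ d
        - (∫ p : EuclideanSpace ℝ (Fin d), ((a1crit d β p : ℝ) : ℂ) *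
              Complex.exp (Complex.I * ((∑ i, p i * (x i - y i) : ℝ) : ℂ)))
            / ((2 * Real.pi : ℝ) : ℂ) ^ d‖ ≤ ε := by
  intro ε hε
  obtain ⟨R, hR⟩ := isBounded_iff_forall_norm_le.1 hΛb
  have hβ' : 0 < β / (2 + d / 2 : ℝ) := by positivity
  have hA := ku_a1_integrable d hd hβ
  have hA' := ku_a1_integrable d hd hβ'
  have hSm : ∀ L, Measurable fun p => kuS d β L (zL L) (kuK d (2 * Real.pi / L) p) := fun L =>
    (measurable_of_countable (kuS d β L (zL L))).comp (kuK_measurable d _)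
  have hSi : ∀ L, 0 < L → Integrable fun p => kuS d β L (zL L) (kuK d (2 * Real.pi / L) p) :=
    fun L hL => hA'.mono' (hSm L).aestronglyMeasurable
      (Eventually.of_forall fun p => kuS_bound d hβ hL (hz L) p)
  have hne : Nontrivial (EuclideanSpace ℝ (Fin d)) := by
    have : Nonempty (Fin d) := ⟨⟨0, by omega⟩⟩
    infer_instance
  -- dominated convergence
  have hT1 : Tendsto (fun L => ∫ p, |kuS d β L (zL L) (kuK d (2 * Real.pi / L) p) - a1crit d β p|)
      atTop (nhds 0) := by
    have := tendsto_integral_filter_of_dominated_convergence (μ := volume) (l := atTop)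
      (F := fun (L : ℝ) p => |kuS d β L (zL L) (kuK d (2 * Real.pi / L) p) - a1crit d β p|)
      (f := fun _ => (0 : ℝ)) (fun p => a1crit d (β / (2 + d / 2)) p + a1crit d β p)
      (Eventually.of_forall fun L =>
        ((hSm L).aestronglyMeasurable.sub hA.aestronglyMeasurable).norm)
      ?_ (hA'.add hA) ?_
    · simpa using this
    · filter_upwards [eventually_gt_atTop 0] with L hL
      refine Eventually.of_forall fun p => ?_
      rw [Real.norm_eq_abs, abs_abs]
      refine (abs_sub _ _).trans (add_le_add (kuS_bound d hβ hL (hz L) p) ?_)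
      rw [abs_of_nonneg (ku_a1_nonneg d hβ p)]
    · filter_upwards [compl_mem_ae_iff.2 (measure_singleton (0 : EuclideanSpace ℝ (Fin d)))]
        with p hp
      have := ((kuS_tendsto d hβ zL hz1 p hp).sub_const (a1crit d β p)).abs
      simpa using this
  have hT2 : Tendsto (fun L : ℝ => (d * (2 * Real.pi / L * |R|)) * ∫ p, a1crit d β p)
      atTop (nhds 0) := by
    have hh : Tendsto (fun L : ℝ => 2 * Real.pi / L) atTop (nhds 0) :=
      tendsto_const_nhds.div_atTop tendsto_id
    simpa using ((hh.mul_const |R|).const_mul (d : ℝ)).mul_const (∫ p, a1crit d β p)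
  have hT := (hT1.add hT2).mul_const ((2 * Real.pi) ^ d)⁻¹
  simp only [add_zero, zero_mul] at hT
  obtain ⟨L₁, hL₁⟩ := eventually_atTop.1 (hT.eventually (gt_mem_nhds hε))
  refine ⟨max L₁ 1, fun L hL x hx y hy => ?_⟩
  have hLpos : 0 < L := lt_of_lt_of_le one_pos ((le_max_right _ _).trans hL)
  refine le_trans ?_ (hL₁ L ((le_max_left _ _).trans hL)).le
  set h := 2 * Real.pi / L with hdef
  have hh : 0 < h := by positivity
  have hw : ∀ i, |x i - y i| ≤ 2 * |R| := by
    intro i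
    have h1 := PiLp.norm_apply_le x i
    have h2 := PiLp.norm_apply_le y i
    have h3 := hR x hx
    have h4 := hR y hy
    rw [Real.norm_eq_abs] at h1 h2
    have := abs_sub (x i) (y i)
    have := le_abs_self R
    linarith
  set F : (Fin d → ℤ) → ℂ := fun k => ((kuS d β L (zL L) k : ℝ) : ℂ) *
    Complex.exp (Complex.I *
                ((2 * Real.pi * (∑ i, (k i : ℝ) * (x i - y i)) / L : ℝ) : ℂ)) with hFdef
  have hFi : Integrable fun p => F (kuK d h p) := by
    refine (hSi L hLpos).norm.mono'
      ((measurable_of_countable F).comp (kuK_measurable d _)).aestronglyMeasurable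
      (Eventually.of_forall fun p => ?_)
    rw [hFdef]
    simp only
    rw [norm_mul, Complex.norm_exp_I_mul_ofReal, mul_one, Complex.norm_real]
  have hGi : Integrable fun p : EuclideanSpace ℝ (Fin d) => ((a1crit d β p : ℝ) : ℂ) *
      Complex.exp (Complex.I * ((∑ i, p i * (x i - y i) : ℝ) : ℂ)) := by
    refine hA.norm.mono' (hA.ofReal.aestronglyMeasurable.mul
      (Continuous.aestronglyMeasurable (by fun_prop))) (Eventually.of_forall fun p => ?_)
    rw [norm_mul, Complex.norm_exp_I_mul_ofReal, mul_one, Complex.norm_real]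
  have hsum : (∑' k : Fin d → ℤ, if k = 0 then 0 else
            ((zL L * gk d β L k / (1 - zL L * gk d β L k) : ℝ) : ℂ) *
              Complex.exp (Complex.I *
                ((2 * Real.pi * (∑ i, (k i : ℝ) * (x i - y i)) / L : ℝ) : ℂ))) = ∑' k, F k := by
    refine tsum_congr fun k => ?_
    rw [hFdef]
    by_cases hk : k = 0
    · simp [kuS, hk]
    · simp only [kuS, hk, if_false]
  have hpi : ((2 * Real.pi : ℝ) : ℂ) ≠ 0 := by
    exact_mod_cast (by positivity : (2 * Real.pi : ℝ) ≠ 0)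
  have hLc : (L : ℂ) ≠ 0 := by exact_mod_cast hLpos.ne'
  have hsum2 : (∑' k, F k) / (L : ℂ) ^ d
      = (∫ p, F (kuK d h p)) / ((2 * Real.pi : ℝ) : ℂ) ^ d := by
    rw [ku_sum_eq_integral d hh F hFi, hdef, Complex.ofReal_div, div_pow]
    field_simp
  rw [hsum, hsum2, ← sub_div, ← integral_sub hFi hGi, norm_div, norm_pow, Complex.norm_real,
    Real.norm_of_nonneg (by positivity : (0 : ℝ) ≤ 2 * Real.pi), div_eq_mul_inv]
  refine mul_le_mul_of_nonneg_right ?_ (by positivity)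
  have hD : Integrable fun p => |kuS d β L (zL L) (kuK d h p) - a1crit d β p| :=
    ((hSi L hLpos).sub hA).norm
  rw [← integral_const_mul, ← integral_add hD (hA.const_mul _)]
  refine norm_integral_le_of_norm_le (hD.add (hA.const_mul _)) (Eventually.of_forall fun p => ?_)
  simp only [hFdef]
  set s := kuS d β L (zL L) (kuK d h p)
  set a := a1crit d β p
  set u : ℝ := 2 * Real.pi * (∑ i, (kuK d h p i : ℝ) * (x i - y i)) / L with hu
  set v : ℝ := ∑ i, p i * (x i - y i) with hv
  have huv : |u - v| ≤ d * (h * |R|) := by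
    have e : u - v = ∑ i, (h * (kuK d h p i : ℝ) - p i) * (x i - y i) := by
      rw [hu, hv, hdef, Finset.mul_sum, Finset.sum_div, ← Finset.sum_sub_distrib]
      refine Finset.sum_congr rfl fun i _ => ?_
      ring
    rw [e]
    calc _ ≤ ∑ i, |(h * (kuK d h p i : ℝ) - p i) * (x i - y i)| := Finset.abs_sum_le_sum_abs _ _
      _ ≤ ∑ _i : Fin d, (h / 2) * (2 * |R|) := by
        refine Finset.sum_le_sum fun i _ => ?_
        rw [abs_mul]
        exact mul_le_mul (kuK_close d hh p i) (hw i) (abs_nonneg _) (by positivity)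
      _ = _ := by
        rw [Finset.sum_const, Finset.card_univ, Fintype.card_fin, nsmul_eq_mul]
        ring
  have ha : 0 ≤ a := ku_a1_nonneg d hβ p
  have e : (s : ℂ) * Complex.exp (Complex.I * (u : ℂ)) - (a : ℂ) * Complex.exp (Complex.I * (v : ℂ))
      = ((s - a : ℝ) : ℂ) * Complex.exp (Complex.I * (u : ℂ)) + (a : ℂ) *
        (Complex.exp (Complex.I * (u : ℂ)) - Complex.exp (Complex.I * (v : ℂ))) := by
    push_cast; ring
  rw [e]
  refine (norm_add_le _ _).trans (add_le_add ?_ ?_)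
  · rw [norm_mul, Complex.norm_exp_I_mul_ofReal, mul_one, Complex.norm_real, Real.norm_eq_abs]
  · rw [norm_mul, Complex.norm_real, Real.norm_of_nonneg ha, mul_comm]
    exact mul_le_mul_of_nonneg_right ((ku_exp_diff u v).trans huv) ha
end
end

section
/- Let L_n → ∞ and N_n ∈ ℕ with N_n/L_n^d → ρ, where 0 < ρ < ρ_c. Then z₀(L_n, N_n) converges to z_*, the unique z ∈ (0,1) satisfying ∫_{ℝ^d} a_1(p; z) dp/(2π)^d = ρ. -/
open MeasureTheory Filter

noncomputable section

/-- `a₁(p;z) = z e^{-β|p|²}/(1 - z e^{-β|p|²})`. -/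
def a1 (d : ℕ) (β : ℝ) (z : ℝ) (p : EuclideanSpace ℝ (Fin d)) : ℝ :=
  z * Real.exp (-β * ‖p‖ ^ 2) / (1 - z * Real.exp (-β * ‖p‖ ^ 2))

/-- the gaussian on `Fin d → ℝ` -/
def gs (d : ℕ) (β : ℝ) (x : Fin d → ℝ) : ℝ := Real.exp (-β * ∑ i, x i ^ 2)

/-- `a1` on `Fin d → ℝ` -/
def ph (d : ℕ) (β z : ℝ) (x : Fin d → ℝ) : ℝ := z * gs d β x / (1 - z * gs d β x)

theorem integral_a1_eq (d : ℕ) (β z : ℝ) :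
    ∫ p : EuclideanSpace ℝ (Fin d), a1 d β z p = ∫ x, ph d β z x := by
  rw [← (PiLp.volume_preserving_ofLp (Fin d)).integral_comp
    (MeasurableEquiv.toLp 2 _).symm.measurableEmbedding]
  refine integral_congr_ae (ae_of_all _ fun p => ?_)
  simp [a1, ph, gs, EuclideanSpace.norm_sq_eq]

theorem gs_pos (d : ℕ) (β : ℝ) (x : Fin d → ℝ) : 0 < gs d β x := Real.exp_pos _

theorem gs_le_one (d : ℕ) {β : ℝ} (hβ : 0 < β) (x : Fin d → ℝ) : gs d β x ≤ 1 := by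
  unfold gs
  rw [Real.exp_le_one_iff]
  have : 0 ≤ ∑ i, x i ^ 2 := Finset.sum_nonneg fun i _ => sq_nonneg _
  nlinarith

theorem gs_lt_one (d : ℕ) {β : ℝ} (hβ : 0 < β) (x : Fin d → ℝ) (hx : x ≠ 0) : gs d β x < 1 := by
  unfold gs
  rw [Real.exp_lt_one_iff]
  obtain ⟨i, hi⟩ := Function.ne_iff.mp hx
  have : 0 < ∑ i, x i ^ 2 := Finset.sum_pos' (fun i _ => sq_nonneg _)
    ⟨i, Finset.mem_univ _, by have : x i ≠ 0 := hi; positivity⟩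
  nlinarith

theorem continuous_gs (d : ℕ) (β : ℝ) : Continuous (gs d β) := by
  unfold gs; fun_prop

theorem integrable_gs (d : ℕ) {β : ℝ} (hβ : 0 < β) : Integrable (gs d β) := by
  have := Integrable.fintype_prod (ι := Fin d) (f := fun _ (t : ℝ) => Real.exp (-β * t ^ 2))
    (μ := fun _ => volume) (fun _ => integrable_exp_neg_mul_sq hβ)
  rw [volume_pi]
  convert! this using 2 with x
  rw [gs, Finset.mul_sum, Real.exp_sum]

theorem measurable_ph (d : ℕ) (β z : ℝ) : Measurable (ph d β z) := by
  have := (continuous_gs d β).measurable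
  unfold ph; fun_prop

theorem frac_mono {s t : ℝ} (hst : s ≤ t) (ht : t < 1) : s / (1 - s) ≤ t / (1 - t) := by
  rw [div_le_div_iff₀ (by linarith) (by linarith)]; nlinarith

theorem frac_strict {s t : ℝ} (hst : s < t) (ht : t < 1) : s / (1 - s) < t / (1 - t) := by
  rw [div_lt_div_iff₀ (by linarith) (by linarith)]; nlinarith

theorem ph_nonneg (d : ℕ) {β z : ℝ} (hβ : 0 < β) (h0 : 0 ≤ z) (h1 : z ≤ 1) (x : Fin d → ℝ) :
    0 ≤ ph d β z x := by
  have h := gs_pos d β x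
  have h' := gs_le_one d hβ x
  exact div_nonneg (by positivity) (by nlinarith)

theorem zgs_lt (d : ℕ) {β z : ℝ} (hβ : 0 < β) (h1 : z < 1) (x : Fin d → ℝ) :
    z * gs d β x < 1 := by
  have h := gs_pos d β x
  have h' := gs_le_one d hβ x
  nlinarith

theorem ph_le (d : ℕ) {β z : ℝ} (hβ : 0 < β) (h0 : 0 ≤ z) (h1 : z < 1) (x : Fin d → ℝ) :
    ph d β z x ≤ (1 - z)⁻¹ * gs d β x := by
  have h := gs_pos d β x
  have h' := gs_le_one d hβ x
  have h1' : 0 < 1 - z := by linarith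
  unfold ph
  rw [inv_mul_eq_div, div_le_div_iff₀ (by linarith [zgs_lt d hβ h1 x]) h1']
  apply mul_le_mul (by nlinarith) (by nlinarith) h1'.le h.le

theorem ph_mono (d : ℕ) {β z w : ℝ} (hβ : 0 < β) (hzw : z ≤ w) (h1 : w < 1) (x : Fin d → ℝ) :
    ph d β z x ≤ ph d β w x := by
  have h := gs_pos d β x
  exact frac_mono (by gcongr) (zgs_lt d hβ h1 x)

theorem ph_mono' (d : ℕ) {β z w : ℝ} (hβ : 0 < β) (hzw : z ≤ w) (h1 : w ≤ 1) (x : Fin d → ℝ)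
    (hx : x ≠ 0) : ph d β z x ≤ ph d β w x := by
  have h := gs_pos d β x
  have h' := gs_lt_one d hβ x hx
  exact frac_mono (by gcongr) (by nlinarith)

theorem integrable_ph (d : ℕ) {β z : ℝ} (hβ : 0 < β) (h0 : 0 ≤ z) (h1 : z < 1) :
    Integrable (ph d β z) := by
  refine ((integrable_gs d hβ).const_mul (1 - z)⁻¹).mono'
    (measurable_ph d β z).aestronglyMeasurable (ae_of_all _ fun x => ?_)
  rw [Real.norm_of_nonneg (ph_nonneg d hβ h0 h1.le x)]
  exact ph_le d hβ h0 h1 x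

theorem integral_ph_strict (d : ℕ) {β z w : ℝ} (hβ : 0 < β) (h0 : 0 ≤ z) (hzw : z < w)
    (h1 : w < 1) : ∫ x, ph d β z x < ∫ x, ph d β w x := by
  have hpos : ∀ x, 0 < ph d β w x - ph d β z x := fun x => by
    have h := gs_pos d β x
    exact sub_pos.mpr (frac_strict (by gcongr) (zgs_lt d hβ h1 x))
  have hi1 := integrable_ph d hβ h0 (hzw.trans h1)
  have hi2 := integrable_ph d hβ (h0.trans hzw.le) h1
  rw [← sub_pos, ← integral_sub hi2 hi1,
    integral_pos_iff_support_of_nonneg (fun x => (hpos x).le) (hi2.sub hi1)]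
  have : Function.support (fun x => ph d β w x - ph d β z x) = Set.univ := by
    ext x; simpa using (hpos x).ne'
  rw [this]
  exact Measure.measure_univ_pos.2 (NeZero.ne _)

theorem continuousOn_integral_ph (d : ℕ) (hd : 2 < d) {β : ℝ} (hβ : 0 < β)
    (hint : Integrable (ph d β 1)) :
    ContinuousOn (fun z => ∫ x, ph d β z x) (Set.Icc 0 1) := by
  haveI : Nonempty (Fin d) := ⟨⟨0, by omega⟩⟩
  have hne : ∀ᵐ x : Fin d → ℝ, x ≠ 0 := by
    simp [ae_iff]
  intro z hz
  refine continuousWithinAt_of_dominated (bound := ph d β 1)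
    (Eventually.of_forall fun w => (measurable_ph d β w).aestronglyMeasurable) ?_ hint ?_
  · filter_upwards [self_mem_nhdsWithin] with w hw
    filter_upwards [hne] with x hx
    rw [Real.norm_of_nonneg (ph_nonneg d hβ hw.1 hw.2 x)]
    exact ph_mono' d hβ hw.2 le_rfl x hx
  · filter_upwards [hne] with x hx
    have h := gs_pos d β x
    have h' := gs_lt_one d hβ x hx
    have : 1 - z * gs d β x ≠ 0 := by have := hz.2; nlinarith
    apply ContinuousAt.continuousWithinAt
    unfold ph
    fun_prop (disch := assumption)

/-- coordinatewise floor -/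
def flr (d : ℕ) (x : Fin d → ℝ) : Fin d → ℤ := fun i => ⌊x i⌋

theorem measurable_flr (d : ℕ) : Measurable (flr d) := by
  unfold flr; fun_prop

theorem map_flr (d : ℕ) : Measure.map (flr d) volume = Measure.count := by
  refine Measure.ext_of_singleton fun k => ?_
  rw [Measure.map_apply (measurable_flr d) (measurableSet_singleton k), Measure.count_singleton]
  have : flr d ⁻¹' {k} = Set.pi Set.univ fun i => Set.Ico (k i : ℝ) (k i + 1) := by
    ext x
    simp [flr, funext_iff, Int.floor_eq_iff]
  rw [this, Real.volume_pi_Ico]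
  simp

theorem tsum_eq_integral (d : ℕ) (f : (Fin d → ℤ) → ℝ)
    (hf : Integrable (fun x => f (flr d x))) :
    Summable f ∧ ∑' k, f k = ∫ x, f (flr d x) := by
  have hm : Measurable f := measurable_of_countable f
  have h1 : Integrable f (Measure.count : Measure (Fin d → ℤ)) := by
    rw [← map_flr]
    exact (integrable_map_measure hm.aestronglyMeasurable (measurable_flr d).aemeasurable).2 hf
  refine ⟨?_, ?_⟩
  · exact (integrable_count_iff.1 h1).of_norm
  · rw [← integral_map (measurable_flr d).aemeasurable hm.aestronglyMeasurable, map_flr,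
      integral_countable' h1]
    simp

/-- rounding to the lattice of mesh `ε` -/
def rnd (d : ℕ) (ε : ℝ) (x : Fin d → ℝ) : Fin d → ℝ := fun i => ε * ⌊ε⁻¹ * x i⌋

theorem measurable_rnd (d : ℕ) (ε : ℝ) : Measurable (rnd d ε) := by
  unfold rnd; fun_prop

theorem rnd_close (d : ℕ) {ε : ℝ} (hε : 0 < ε) (x : Fin d → ℝ) (i : Fin d) :
    |rnd d ε x i - x i| ≤ ε := by
  unfold rnd
  have h1 := Int.floor_le (ε⁻¹ * x i)
  have h2 := (Int.lt_floor_add_one (ε⁻¹ * x i)).le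
  have h3 := mul_le_mul_of_nonneg_left h1 hε.le
  have h4 := mul_le_mul_of_nonneg_left h2 hε.le
  rw [mul_inv_cancel_left₀ hε.ne'] at h3 h4
  rw [abs_le]; constructor <;> linarith

theorem gs_rnd_le (d : ℕ) {β ε : ℝ} (hβ : 0 < β) (hε : 0 < ε) (hε1 : ε ≤ 1) (x : Fin d → ℝ) :
    gs d β (rnd d ε x) ≤ Real.exp (β * d) * gs d (β / 2) x := by
  unfold gs
  rw [← Real.exp_add, Real.exp_le_exp]
  have : ∑ i, (x i ^ 2 / 2 - 1) ≤ ∑ i, rnd d ε x i ^ 2 := by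
    refine Finset.sum_le_sum fun i _ => ?_
    have h := abs_le.1 ((rnd_close d hε x i).trans hε1)
    nlinarith [sq_nonneg (2 * rnd d ε x i - x i)]
  rw [Finset.sum_sub_distrib, ← Finset.sum_div] at this
  simp at this
  nlinarith

theorem ph_rnd_le (d : ℕ) {β z ε : ℝ} (hβ : 0 < β) (h0 : 0 ≤ z) (h1 : z < 1) (hε : 0 < ε)
    (hε1 : ε ≤ 1) (x : Fin d → ℝ) :
    ‖ph d β z (rnd d ε x)‖ ≤ (1 - z)⁻¹ * (Real.exp (β * d) * gs d (β / 2) x) := by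
  rw [Real.norm_of_nonneg (ph_nonneg d hβ h0 h1.le _)]
  have : 0 < 1 - z := by linarith
  exact (ph_le d hβ h0 h1 _).trans (by gcongr; exact gs_rnd_le d hβ hε hε1 x)

theorem integrable_bd (d : ℕ) {β z : ℝ} (hβ : 0 < β) :
    Integrable (fun x => (1 - z)⁻¹ * (Real.exp (β * d) * gs d (β / 2) x)) :=
  ((integrable_gs d (half_pos hβ)).const_mul _).const_mul _

theorem integrable_ph_rnd (d : ℕ) {β z ε : ℝ} (hβ : 0 < β) (h0 : 0 ≤ z) (h1 : z < 1) (hε : 0 < ε)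
    (hε1 : ε ≤ 1) : Integrable (fun x => ph d β z (rnd d ε x)) :=
  (integrable_bd d hβ).mono'
    ((measurable_ph d β z).comp (measurable_rnd d ε)).aestronglyMeasurable
    (ae_of_all _ (ph_rnd_le d hβ h0 h1 hε hε1))

theorem tendsto_integral_rnd (d : ℕ) {β z : ℝ} (hβ : 0 < β) (h0 : 0 ≤ z) (h1 : z < 1)
    (ε : ℕ → ℝ) (hpos : ∀ n, 0 < ε n) (hε : Tendsto ε atTop (nhds 0)) :
    Tendsto (fun n => ∫ x, ph d β z (rnd d (ε n) x)) atTop (nhds (∫ x, ph d β z x)) := by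
  refine tendsto_integral_filter_of_dominated_convergence
    (fun x => (1 - z)⁻¹ * (Real.exp (β * d) * gs d (β / 2) x))
    (Eventually.of_forall fun n =>
      ((measurable_ph d β z).comp (measurable_rnd d (ε n))).aestronglyMeasurable) ?_
    (integrable_bd d hβ) (ae_of_all _ fun x => ?_)
  · filter_upwards [hε.eventually_le_const one_pos] with n hn
    exact ae_of_all _ (ph_rnd_le d hβ h0 h1 (hpos n) hn)
  · have hr : Tendsto (fun n => rnd d (ε n) x) atTop (nhds x) := by
      rw [tendsto_pi_nhds]
      intro i
      rw [tendsto_iff_norm_sub_tendsto_zero]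
      exact squeeze_zero (fun _ => norm_nonneg _) (fun n => rnd_close d (hpos n) x i) hε
    have hc : Continuous (ph d β z) := by
      have := continuous_gs d β
      unfold ph
      exact Continuous.div (by fun_prop) (by fun_prop)
        (fun x => by have := zgs_lt d hβ h1 x; linarith)
    exact (hc.tendsto x).comp hr

theorem sum_eq (d : ℕ) {β z L : ℝ} (hβ : 0 < β) (h0 : 0 ≤ z) (h1 : z < 1) (hL : 0 < L)
    (hε1 : 2 * Real.pi / L ≤ 1) :
    Summable (fun k => z * gk d β L k / (1 - z * gk d β L k)) ∧
    (∑' k, z * gk d β L k / (1 - z * gk d β L k)) / L ^ d =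
      (∫ x, ph d β z (rnd d (2 * Real.pi / L) x)) / (2 * Real.pi) ^ d := by
  set ε := 2 * Real.pi / L with hε
  have hεpos : 0 < ε := by positivity
  have hfun : (fun x => z * gk d β L (flr d x) / (1 - z * gk d β L (flr d x))) =
      fun x => ph d β z (rnd d ε (ε • x)) := by
    funext x
    have : gk d β L (flr d x) = gs d β (rnd d ε (ε • x)) := by
      unfold gk gs
      congr 2
      refine Finset.sum_congr rfl fun i _ => ?_
      simp only [rnd, flr, Pi.smul_apply, smul_eq_mul]
      rw [inv_mul_cancel_left₀ hεpos.ne', hε]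
      ring
    simp only [this, ph]
  have hi : Integrable (fun x => ph d β z (rnd d ε (ε • x))) :=
    (integrable_comp_smul_iff volume (fun x => ph d β z (rnd d ε x)) hεpos.ne').2
      (integrable_ph_rnd d hβ h0 h1 hεpos hε1)
  obtain ⟨hs, ht⟩ := tsum_eq_integral d (fun k => z * gk d β L k / (1 - z * gk d β L k))
    (by rw [hfun]; exact hi)
  refine ⟨hs, ?_⟩
  rw [ht, hfun, Measure.integral_comp_smul volume (fun x => ph d β z (rnd d ε x))]
  rw [Module.finrank_fin_fun, abs_of_pos (by positivity), hε, smul_eq_mul]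
  have := Real.pi_pos
  rw [div_pow]
  field_simp

/-- Lemma 5, case (a): in the thermodynamic limit `N_n/L_n^d → ρ` with
`0 < ρ < ρ_c`, the saddle points `z₀(L_n,N_n)` converge to `z_*`, the unique
`z ∈ (0,1)` with `∫ a₁(p;z) dp/(2π)^d = ρ`. -/
theorem saddle_point_limit_subcritical (d : ℕ) (hd : 2 < d) (β : ℝ) (hβ : 0 < β)
    (L : ℕ → ℝ) (hLpos : ∀ n, 0 < L n) (hL : Tendsto L atTop atTop)
    (N : ℕ → ℕ) (hN : ∀ n, 1 ≤ N n) (ρ : ℝ) (hρpos : 0 < ρ)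
    (hρsub : ρ < (∫ p : EuclideanSpace ℝ (Fin d), a1 d β 1 p) / (2 * Real.pi) ^ d)
    (hdens : Tendsto (fun n => (N n : ℝ) / L n ^ d) atTop (nhds ρ))
    (z : ℕ → ℝ)
    (hz : ∀ n, z n ∈ Set.Ioo (0 : ℝ) 1 ∧
      (∑' k : Fin d → ℤ, z n * gk d β (L n) k / (1 - z n * gk d β (L n) k)) = N n) :
    (∃! w : ℝ, w ∈ Set.Ioo (0 : ℝ) 1 ∧
      (∫ p : EuclideanSpace ℝ (Fin d), a1 d β w p) / (2 * Real.pi) ^ d = ρ) ∧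
    ∀ w : ℝ, w ∈ Set.Ioo (0 : ℝ) 1 →
      (∫ p : EuclideanSpace ℝ (Fin d), a1 d β w p) / (2 * Real.pi) ^ d = ρ →
      Tendsto z atTop (nhds w) := by
  simp only [integral_a1_eq] at *
  have hP : 0 < (2 * Real.pi) ^ d := by positivity
  have hint : Integrable (ph d β 1) := by
    by_contra h
    rw [integral_undef h, zero_div] at hρsub
    linarith
  have hstrict : ∀ {u v : ℝ}, 0 ≤ u → u < v → v < 1 →
      (∫ x, ph d β u x) / (2 * Real.pi) ^ d < (∫ x, ph d β v x) / (2 * Real.pi) ^ d :=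
    fun h0 h h1 => div_lt_div_of_pos_right (integral_ph_strict d hβ h0 h h1) hP
  constructor
  · have hc : ContinuousOn (fun w => (∫ x, ph d β w x) / (2 * Real.pi) ^ d) (Set.Icc 0 1) :=
      (continuousOn_integral_ph d hd hβ hint).div_const _
    have h00 : (∫ x, ph d β 0 x) / (2 * Real.pi) ^ d = 0 := by simp [ph]
    obtain ⟨w, hw, hwρ⟩ := intermediate_value_Ioo (zero_le_one' ℝ) hc
      (show ρ ∈ Set.Ioo _ _ from ⟨by simpa only [h00] using hρpos, hρsub⟩)
    refine ⟨w, ⟨hw, hwρ⟩, ?_⟩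
    rintro v ⟨hv, hvρ⟩
    simp only at hwρ
    rcases lt_trichotomy v w with h | h | h
    · have := hstrict hv.1.le h hw.2
      linarith
    · exact h
    · have := hstrict hw.1.le h hv.2
      linarith
  · intro w hw hwρ
    have hε : Tendsto (fun n => 2 * Real.pi / L n) atTop (nhds 0) := hL.const_div_atTop _
    have hεpos : ∀ n, 0 < 2 * Real.pi / L n := fun n => by have := hLpos n; positivity
    have hε1 := hε.eventually_le_const one_pos
    have key : ∀ v, 0 ≤ v → v < 1 → Tendsto
        (fun n => (∑' k, v * gk d β (L n) k / (1 - v * gk d β (L n) k)) / L n ^ d) atTop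
        (nhds ((∫ x, ph d β v x) / (2 * Real.pi) ^ d)) := by
      intro v h0 h1
      refine ((tendsto_integral_rnd d hβ h0 h1 _ hεpos hε).div_const _).congr' ?_
      filter_upwards [hε1] with n hn
      exact (sum_eq d hβ h0 h1 (hLpos n) hn).2.symm
    have mono : ∀ n, 2 * Real.pi / L n ≤ 1 → ∀ u v, 0 ≤ u → u ≤ v → v < 1 →
        (∑' k, u * gk d β (L n) k / (1 - u * gk d β (L n) k)) / L n ^ d ≤
        (∑' k, v * gk d β (L n) k / (1 - v * gk d β (L n) k)) / L n ^ d := by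
      intro n hn u v h0 huv h1
      have hLn := hLpos n
      refine div_le_div_of_nonneg_right ?_ (by positivity)
      refine Summable.tsum_le_tsum (fun k => ?_)
        (sum_eq d hβ h0 (huv.trans_lt h1) hLn hn).1 (sum_eq d hβ (h0.trans huv) h1 hLn hn).1
      exact ph_mono d hβ huv h1 (fun i => 2 * Real.pi * (k i : ℝ) / L n)
    rw [tendsto_order]
    constructor
    · intro a ha
      have hb0 : 0 ≤ max a 0 := le_max_right _ _
      have hbw : max a 0 < w := max_lt ha hw.1
      have hb := hstrict hb0 hbw hw.2
      rw [hwρ] at hb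
      filter_upwards [hε1, (key _ hb0 (hbw.trans hw.2)).eventually_lt hdens hb] with n hn hlt
      by_contra hcon
      push Not at hcon
      have := mono n hn _ _ (hz n).1.1.le (hcon.trans (le_max_left _ 0)) (hbw.trans hw.2)
      rw [(hz n).2] at this
      linarith
    · intro a ha
      obtain ⟨b, hwb, hb'⟩ := exists_between (lt_min ha hw.2)
      have hba := hb'.trans_le (min_le_left _ _)
      have hb1 := hb'.trans_le (min_le_right _ _)
      have hb := hstrict hw.1.le hwb hb1
      rw [hwρ] at hb
      filter_upwards [hε1, hdens.eventually_lt (key _ (hw.1.le.trans hwb.le) hb1) hb] with n hn hlt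
      by_contra hcon
      push Not at hcon
      have := mono n hn _ _ (hw.1.le.trans hwb.le) (hba.le.trans hcon) (hz n).1.2
      rw [(hz n).2] at this
      linarith
end
end

section
/- Let L_n → ∞ and N_n ∈ ℕ with N_n/L_n^d → ρ, where ρ > ρ_c. Then L_n^d (1 − z₀(L_n, N_n)) → 1/(ρ − ρ_c); in particular z₀(L_n, N_n) → 1. -/
open MeasureTheory Filter

noncomputable section

/-- the Bose function -/
def bose (z u : ℝ) : ℝ := z * Real.exp (-u) / (1 - z * Real.exp (-u))

/-- dominating function -/
def bdom (u : ℝ) : ℝ := Real.exp (-(u / 2)) / u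

lemma bose_nonneg {z u : ℝ} (hz0 : 0 < z) (hz1 : z ≤ 1) (hu : 0 < u) : 0 ≤ bose z u := by
  have h1 : Real.exp (-u) < 1 := by rw [Real.exp_lt_one_iff]; linarith
  have h2 := Real.exp_pos (-u)
  unfold bose
  apply div_nonneg (by positivity)
  nlinarith

lemma bose_le_one {z u : ℝ} (hz0 : 0 < z) (hz1 : z ≤ 1) (hu : 0 < u) : bose z u ≤ bose 1 u := by
  have h1 : Real.exp (-u) < 1 := by rw [Real.exp_lt_one_iff]; linarith
  have h2 := Real.exp_pos (-u)
  unfold bose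
  have h3 : z * Real.exp (-u) ≤ 1 * Real.exp (-u) := by gcongr
  apply div_le_div₀ (by positivity) h3 (by linarith) (by linarith)

lemma bose_one_le {u : ℝ} (hu : 0 < u) : bose 1 u ≤ bdom u := by
  have h1 : Real.exp (-u) < 1 := by rw [Real.exp_lt_one_iff]; linarith
  unfold bose bdom
  rw [div_le_div_iff₀ (by linarith) hu]
  have h := Real.self_le_sinh_iff.2 (by linarith : 0 ≤ u / 2)
  rw [Real.sinh_eq] at h
  have e1 : Real.exp (-u) = Real.exp (-(u/2)) * Real.exp (-(u/2)) := by
    rw [← Real.exp_add]; congr 1; ring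
  have e2 : Real.exp (u/2) * Real.exp (-(u/2)) = 1 := by
    rw [← Real.exp_add]; simp
  have e3 := Real.exp_pos (-(u/2))
  rw [e1]
  set a := Real.exp (-(u/2))
  set b := Real.exp (u/2)
  have : 1 - 1 * (a * a) = a * (b - a) := by linarith
  rw [this]
  have h' : u ≤ b - a := by linarith
  nlinarith [mul_le_mul_of_nonneg_left h' (by positivity : 0 ≤ a * a)]

lemma bdom_anti {u v : ℝ} (hu : 0 < u) (huv : u ≤ v) : bdom v ≤ bdom u := by
  unfold bdom
  apply div_le_div₀ (by positivity) _ hu huv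
  apply Real.exp_le_exp.2; linarith

lemma bose_le_bdom {z u v : ℝ} (hz0 : 0 < z) (hz1 : z ≤ 1) (hu : 0 < u) (huv : u ≤ v) :
    bose z v ≤ bdom u :=
  (bose_le_one hz0 hz1 (hu.trans_le huv)).trans
    ((bose_one_le (hu.trans_le huv)).trans (bdom_anti hu huv))

lemma bdom_integrable (d : ℕ) (hd : 2 < d) (c : ℝ) (hc : 0 < c) :
    Integrable (fun p : EuclideanSpace ℝ (Fin d) => bdom (c * ‖p‖ ^ 2)) := by
  have : Nontrivial (EuclideanSpace ℝ (Fin d)) := by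
    have : Nonempty (Fin d) := ⟨⟨0, by omega⟩⟩
    infer_instance
  rw [integrable_fun_norm_addHaar volume (f := fun r : ℝ => bdom (c * r ^ 2))]
  have h := (integrable_rpow_mul_exp_neg_mul_sq (b := c / 2) (by positivity)
    (s := ((d - 3 : ℕ) : ℝ)) (by have : (0:ℝ) ≤ ((d - 3 : ℕ) : ℝ) := by positivity
                                 linarith)).const_mul c⁻¹
  apply h.integrableOn.congr_fun _ measurableSet_Ioi
  intro y hy
  have hy : 0 < y := hy
  simp only [finrank_euclideanSpace, Fintype.card_fin, smul_eq_mul, Real.rpow_natCast, bdom]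
  have : d - 1 = (d - 3) + 2 := by omega
  rw [this, pow_add]
  field_simp

/-- floor map -/
def fl (d : ℕ) (p : EuclideanSpace ℝ (Fin d)) : Fin d → ℤ := fun i => ⌊p i⌋

lemma fl_meas (d : ℕ) : Measurable (fl d) := by
  unfold fl
  refine measurable_pi_lambda _ fun i => Int.measurable_floor.comp ?_
  fun_prop

lemma map_fl (d : ℕ) : (volume : Measure (EuclideanSpace ℝ (Fin d))).map (fl d) = Measure.count := by
  rw [Measure.ext_iff_singleton]
  intro k
  rw [Measure.map_apply (fl_meas d) (measurableSet_singleton k), Measure.count_singleton]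
  have h : fl d ⁻¹' {k} = (WithLp.ofLp) ⁻¹'
      (Set.pi Set.univ fun i => Set.Ico (k i : ℝ) ((k i : ℝ) + 1)) := by
    ext p
    simp [fl, funext_iff, Int.floor_eq_iff]
  rw [h, (PiLp.volume_preserving_ofLp (Fin d)).measure_preimage
    (MeasurableSet.univ_pi fun i => measurableSet_Ico).nullMeasurableSet, Real.volume_pi_Ico]
  simp

/-- summand with the zero mode removed -/
def fk (d : ℕ) (β L z : ℝ) (k : Fin d → ℤ) : ℝ :=
  if k = 0 then 0 else bose z (β * ∑ i, (2 * Real.pi * (k i : ℝ) / L) ^ 2)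

lemma int_sq_sum_pos {d : ℕ} {k : Fin d → ℤ} (hk : k ≠ 0) : (1:ℝ) ≤ ∑ i, (k i : ℝ) ^ 2 := by
  obtain ⟨i, hi⟩ := Function.ne_iff.1 hk
  have h1 : (1:ℝ) ≤ (k i : ℝ) ^ 2 := by
    have : (1:ℤ) ≤ k i ^ 2 := by
      have : 0 < k i ^ 2 := by
        have : k i ≠ 0 := hi
        positivity
      omega
    exact_mod_cast this
  exact h1.trans (Finset.single_le_sum (f := fun i => (k i : ℝ) ^ 2) (fun j _ => sq_nonneg _)
    (Finset.mem_univ i))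

lemma sum_eq_s14 (d : ℕ) (L : ℝ) (k : Fin d → ℤ) :
    ∑ i, (2 * Real.pi * (k i : ℝ) / L) ^ 2 = (2 * Real.pi / L) ^ 2 * ∑ i, (k i : ℝ) ^ 2 := by
  rw [Finset.mul_sum]
  exact Finset.sum_congr rfl fun i _ => by ring

lemma norm_sq_le (d : ℕ) (x : EuclideanSpace ℝ (Fin d)) (hk : fl d x ≠ 0) :
    ‖x‖ ^ 2 ≤ (2 + 2 * d) * ∑ i, ((fl d x i : ℤ) : ℝ) ^ 2 := by
  have h1 := int_sq_sum_pos hk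
  rw [EuclideanSpace.real_norm_sq_eq]
  have h2 : ∀ i ∈ Finset.univ, x i ^ 2 ≤ 2 * ((fl d x i : ℤ) : ℝ) ^ 2 + 2 := by
    intro i _
    have a := Int.floor_le (x i)
    have b := Int.lt_floor_add_one (x i)
    unfold fl
    set m := ((⌊x i⌋ : ℤ) : ℝ)
    nlinarith [sq_nonneg (m - (x i - m)), mul_nonneg (sub_nonneg.2 a) (sub_nonneg.2 b.le)]
  have h3 := Finset.sum_le_sum h2
  rw [Finset.sum_add_distrib, ← Finset.mul_sum] at h3
  simp at h3
  have : (0:ℝ) ≤ d := by positivity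
  nlinarith

lemma fk_bound (d : ℕ) {β L z : ℝ} (hβ : 0 < β) (hL : 0 < L) (hz0 : 0 < z) (hz1 : z ≤ 1)
    (p : EuclideanSpace ℝ (Fin d)) :
    ‖fk d β L z (fl d ((L / (2 * Real.pi)) • p))‖ ≤ bdom (β / (2 + 2 * d) * ‖p‖ ^ 2) := by
  have hpi := Real.pi_pos
  by_cases hk : fl d ((L / (2 * Real.pi)) • p) = 0
  · simp only [fk, hk, if_true, norm_zero, bdom]
    positivity
  · have hp : p ≠ 0 := by
      rintro rfl
      apply hk
      ext i
      simp [fl]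
    have hp' : 0 < ‖p‖ := norm_pos_iff.2 hp
    have h1 := norm_sq_le d _ hk
    have h0 := int_sq_sum_pos hk
    simp only [fk, hk, if_false]
    rw [sum_eq_s14]
    set S := ∑ i, ((fl d ((L / (2 * Real.pi)) • p) i : ℤ) : ℝ) ^ 2
    have hu : 0 < β / (2 + 2 * d) * ‖p‖ ^ 2 := by positivity
    have huv : β / (2 + 2 * d) * ‖p‖ ^ 2 ≤ β * ((2 * Real.pi / L) ^ 2 * S) := by
      rw [norm_smul, Real.norm_of_nonneg (by positivity)] at h1
      have e : ‖p‖ ^ 2 = (2 * Real.pi / L) ^ 2 * (L / (2 * Real.pi) * ‖p‖) ^ 2 := by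
        field_simp
      rw [e]
      calc _ ≤ β / (2 + 2 * d) * ((2 * Real.pi / L) ^ 2 * ((2 + 2 * d) * S)) := by gcongr
        _ = _ := by field_simp
    rw [Real.norm_of_nonneg (bose_nonneg hz0 hz1 (hu.trans_le huv))]
    exact bose_le_bdom hz0 hz1 hu huv

lemma fk_comp_integrable (d : ℕ) (hd : 2 < d) {β L z : ℝ} (hβ : 0 < β) (hL : 0 < L)
    (hz0 : 0 < z) (hz1 : z ≤ 1) :
    Integrable (fun p => fk d β L z (fl d ((L / (2 * Real.pi)) • p))) := by
  refine (bdom_integrable d hd (β / (2 + 2 * d)) (by positivity)).mono' ?_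
    (ae_of_all _ (fk_bound d hβ hL hz0 hz1))
  apply Measurable.aestronglyMeasurable
  exact (measurable_of_countable (fk d β L z)).comp
    ((fl_meas d).comp (measurable_const_smul (L / (2 * Real.pi))))

lemma fk_integrable_count (d : ℕ) (hd : 2 < d) {β L z : ℝ} (hβ : 0 < β) (hL : 0 < L)
    (hz0 : 0 < z) (hz1 : z ≤ 1) : Integrable (fk d β L z) Measure.count := by
  have hpi := Real.pi_pos
  have h := (integrable_comp_smul_iff volume (fun x => fk d β L z (fl d x))
    (R := L / (2 * Real.pi)) (by positivity)).1 (fk_comp_integrable d hd hβ hL hz0 hz1)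
  rw [← map_fl d]
  exact (integrable_map_measure (measurable_of_countable _).aestronglyMeasurable
    (fl_meas d).aemeasurable).2 h

lemma fk_summable (d : ℕ) (hd : 2 < d) {β L z : ℝ} (hβ : 0 < β) (hL : 0 < L)
    (hz0 : 0 < z) (hz1 : z ≤ 1) : Summable (fk d β L z) :=
  (integrable_count_iff.1 (fk_integrable_count d hd hβ hL hz0 hz1)).of_norm

lemma fk_tsum (d : ℕ) (hd : 2 < d) {β L z : ℝ} (hβ : 0 < β) (hL : 0 < L)
    (hz0 : 0 < z) (hz1 : z ≤ 1) :
    (∑' k, fk d β L z k) / L ^ d =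
      (∫ p, fk d β L z (fl d ((L / (2 * Real.pi)) • p))) / (2 * Real.pi) ^ d := by
  have hpi := Real.pi_pos
  have h1 : ∑' k, fk d β L z k = ∫ x, fk d β L z (fl d x) := by
    rw [← integral_map (fl_meas d).aemeasurable (measurable_of_countable _).aestronglyMeasurable,
      map_fl, integral_countable (fk_integrable_count d hd hβ hL hz0 hz1)]
    simp [Measure.real]
  rw [h1, Measure.integral_comp_smul volume (fun x => fk d β L z (fl d x))]
  rw [abs_of_pos (by positivity)]
  simp only [finrank_euclideanSpace, Fintype.card_fin, smul_eq_mul]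
  rw [div_pow]
  field_simp

lemma sum_tendsto (d : ℕ) (L : ℕ → ℝ) (hLpos : ∀ n, 0 < L n) (hL : Tendsto L atTop atTop)
    (p : EuclideanSpace ℝ (Fin d)) :
    Tendsto (fun n => ∑ i, (2 * Real.pi * ((fl d ((L n / (2 * Real.pi)) • p) i : ℤ) : ℝ) / L n) ^ 2)
      atTop (nhds (‖p‖ ^ 2)) := by
  have hpi := Real.pi_pos
  rw [EuclideanSpace.real_norm_sq_eq]
  refine tendsto_finsetSum _ fun i _ => Tendsto.pow ?_ 2
  have h0 : Tendsto (fun n => p i - 2 * Real.pi / L n) atTop (nhds (p i)) := by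
    simpa using tendsto_const_nhds.sub (hL.const_div_atTop (2 * Real.pi))
  refine tendsto_of_tendsto_of_tendsto_of_le_of_le h0 tendsto_const_nhds ?_ ?_
  · intro n
    have := hLpos n
    have b := Int.lt_floor_add_one (L n / (2 * Real.pi) * p i)
    simp only [fl, PiLp.smul_apply, smul_eq_mul]
    rw [le_div_iff₀ this]
    have e : (p i - 2 * Real.pi / L n) * L n = 2 * Real.pi * (L n / (2 * Real.pi) * p i - 1) := by
      field_simp
    rw [e]
    gcongr
    linarith
  · intro n
    have := hLpos n
    have b := Int.floor_le (L n / (2 * Real.pi) * p i)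
    simp only [fl, PiLp.smul_apply, smul_eq_mul]
    rw [div_le_iff₀ this]
    have e : p i * L n = 2 * Real.pi * (L n / (2 * Real.pi) * p i) := by
      field_simp
    rw [e]
    gcongr

lemma key (d : ℕ) (hd : 2 < d) (β : ℝ) (hβ : 0 < β)
    (L : ℕ → ℝ) (hLpos : ∀ n, 0 < L n) (hL : Tendsto L atTop atTop)
    (z : ℕ → ℝ) (hz0 : ∀ n, 0 < z n) (hz1 : ∀ n, z n ≤ 1) (hz : Tendsto z atTop (nhds 1)) :
    Tendsto (fun n => (∑' k, fk d β (L n) (z n) k) / L n ^ d) atTop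
      (nhds ((∫ p : EuclideanSpace ℝ (Fin d), a1crit d β p) / (2 * Real.pi) ^ d)) := by
  have hpi := Real.pi_pos
  simp_rw [fun n => fk_tsum d hd hβ (hLpos n) (hz0 n) (hz1 n)]
  refine Tendsto.div_const ?_ _
  refine tendsto_integral_of_dominated_convergence
    (fun p => bdom (β / (2 + 2 * d) * ‖p‖ ^ 2))
    (fun n => (fk_comp_integrable d hd hβ (hLpos n) (hz0 n) (hz1 n)).aestronglyMeasurable)
    (bdom_integrable d hd _ (by positivity))
    (fun n => ae_of_all _ (fk_bound d hβ (hLpos n) (hz0 n) (hz1 n))) ?_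
  have : Nontrivial (EuclideanSpace ℝ (Fin d)) := by
    have : Nonempty (Fin d) := ⟨⟨0, by omega⟩⟩
    infer_instance
  filter_upwards [Measure.ae_ne volume (0 : EuclideanSpace ℝ (Fin d))] with p hp
  have hp' : 0 < ‖p‖ := norm_pos_iff.2 hp
  have hs := sum_tendsto d L hLpos hL p
  have hev : ∀ᶠ n in atTop, fl d ((L n / (2 * Real.pi)) • p) ≠ 0 := by
    filter_upwards [hs.eventually_const_lt (by positivity : 0 < ‖p‖ ^ 2)] with n hn h0
    simp [h0] at hn
  have hexp : Tendsto (fun n => z n * Real.exp (-(β * ∑ i, (2 * Real.pi *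
      ((fl d ((L n / (2 * Real.pi)) • p) i : ℤ) : ℝ) / L n) ^ 2))) atTop
      (nhds (1 * Real.exp (-(β * ‖p‖ ^ 2)))) :=
    hz.mul ((Real.continuous_exp.tendsto _).comp (hs.const_mul β).neg)
  have hne : 1 - 1 * Real.exp (-(β * ‖p‖ ^ 2)) ≠ 0 := by
    have : Real.exp (-(β * ‖p‖ ^ 2)) < 1 := by
      rw [Real.exp_lt_one_iff]
      have : 0 < β * ‖p‖ ^ 2 := by positivity
      linarith
    linarith
  have hfin := hexp.div (tendsto_const_nhds.sub hexp) hne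
  have e : a1crit d β p = 1 * Real.exp (-(β * ‖p‖ ^ 2)) / (1 - 1 * Real.exp (-(β * ‖p‖ ^ 2))) := by
    simp [a1crit]
  rw [e]
  refine hfin.congr' ?_
  filter_upwards [hev] with n hn
  simp [fk, hn, bose]

lemma split (d : ℕ) (hd : 2 < d) {β L z : ℝ} (hβ : 0 < β) (hL : 0 < L)
    (hz0 : 0 < z) (hz1 : z < 1) :
    ∑' k : Fin d → ℤ, z * gk d β L k / (1 - z * gk d β L k) = z / (1 - z) + ∑' k, fk d β L z k := by
  have hs := fk_summable d hd hβ hL hz0 hz1.le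
  have e : (fun k : Fin d → ℤ => z * gk d β L k / (1 - z * gk d β L k)) =
      fun k => (Pi.single 0 (z / (1 - z)) : (Fin d → ℤ) → ℝ) k + fk d β L z k := by
    ext k
    by_cases hk : k = 0
    · subst hk
      simp [fk, gk]
    · simp [fk, gk, hk, bose]
  rw [e, Summable.tsum_add (hasSum_pi_single 0 _).summable hs, tsum_pi_single]

lemma fk_mono (d : ℕ) {β L z : ℝ} (hβ : 0 < β) (hL : 0 < L)
    (hz0 : 0 < z) (hz1 : z ≤ 1) (k : Fin d → ℤ) : fk d β L z k ≤ fk d β L 1 k := by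
  unfold fk
  split_ifs with hk
  · exact le_rfl
  · apply bose_le_one hz0 hz1
    rw [sum_eq_s14]
    have := int_sq_sum_pos hk
    have hpi := Real.pi_pos
    positivity

/-- Lemma 5, case (b) and (iv): in the thermodynamic limit `N_n/L_n^d → ρ` with
`ρ > ρ_c`, one has `L_n^d (1 - z₀(L_n,N_n)) → 1/(ρ - ρ_c)`; in particular
`z₀(L_n,N_n) → 1`. -/
theorem saddle_point_limit_supercritical (d : ℕ) (hd : 2 < d) (β : ℝ) (hβ : 0 < β)
    (L : ℕ → ℝ) (hLpos : ∀ n, 0 < L n) (hL : Tendsto L atTop atTop)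
    (N : ℕ → ℕ) (hN : ∀ n, 1 ≤ N n) (ρ : ℝ)
    (hρsup : (∫ p : EuclideanSpace ℝ (Fin d), a1crit d β p) / (2 * Real.pi) ^ d < ρ)
    (hdens : Tendsto (fun n => (N n : ℝ) / L n ^ d) atTop (nhds ρ))
    (z : ℕ → ℝ)
    (hz : ∀ n, z n ∈ Set.Ioo (0 : ℝ) 1 ∧
      (∑' k : Fin d → ℤ, z n * gk d β (L n) k / (1 - z n * gk d β (L n) k)) = N n) :
    Tendsto (fun n => L n ^ d * (1 - z n)) atTop
      (nhds (1 / (ρ - (∫ p : EuclideanSpace ℝ (Fin d), a1crit d β p) / (2 * Real.pi) ^ d))) ∧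
    Tendsto z atTop (nhds 1) := by
  set ρc := (∫ p : EuclideanSpace ℝ (Fin d), a1crit d β p) / (2 * Real.pi) ^ d with hρc
  have hz0 : ∀ n, 0 < z n := fun n => (hz n).1.1
  have hz1 : ∀ n, z n < 1 := fun n => (hz n).1.2
  have hLd : ∀ n, 0 < L n ^ d := fun n => pow_pos (hLpos n) d
  -- rescaled condensate term
  have hx : ∀ n, z n / (1 - z n) / L n ^ d =
      (N n : ℝ) / L n ^ d - (∑' k, fk d β (L n) (z n) k) / L n ^ d := by
    intro n
    rw [← (hz n).2, split d hd hβ (hLpos n) (hz0 n) (hz1 n)]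
    ring
  have hlow : Tendsto (fun n => (N n : ℝ) / L n ^ d - (∑' k, fk d β (L n) 1 k) / L n ^ d) atTop
      (nhds (ρ - ρc)) :=
    hdens.sub (key d hd β hβ L hLpos hL (fun _ => 1) (fun _ => one_pos) (fun _ => le_rfl)
      tendsto_const_nhds)
  have hc : 0 < (ρ - ρc) / 2 := by linarith
  have hev : ∀ᶠ n in atTop, (ρ - ρc) / 2 < z n / (1 - z n) / L n ^ d := by
    filter_upwards [hlow.eventually_const_lt (by linarith : (ρ - ρc) / 2 < ρ - ρc)] with n hn
    refine hn.trans_le ?_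
    rw [hx n]
    have := Summable.tsum_le_tsum (fk_mono d hβ (hLpos n) (hz0 n) (hz1 n).le)
      (fk_summable d hd hβ (hLpos n) (hz0 n) (hz1 n).le)
      (fk_summable d hd hβ (hLpos n) one_pos le_rfl)
    have h2 := hLd n
    gcongr
  have hLdt : Tendsto (fun n => L n ^ d) atTop atTop :=
    (tendsto_pow_atTop (by omega)).comp hL
  have hzt : Tendsto z atTop (nhds 1) := by
    have h0 : Tendsto (fun n => 1 - ((ρ - ρc) / 2)⁻¹ / L n ^ d) atTop (nhds 1) := by
      simpa using tendsto_const_nhds.sub (hLdt.const_div_atTop ((ρ - ρc) / 2)⁻¹)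
    refine tendsto_of_tendsto_of_tendsto_of_le_of_le' h0 tendsto_const_nhds ?_
      (Eventually.of_forall fun n => (hz1 n).le)
    filter_upwards [hev] with n hn
    have h1 : 0 < 1 - z n := by linarith [hz1 n]
    have h2 := hLd n
    rw [lt_div_iff₀ h2, lt_div_iff₀ h1] at hn
    have : 1 - z n ≤ ((ρ - ρc) / 2)⁻¹ / L n ^ d := by
      rw [le_div_iff₀ h2, inv_eq_one_div, le_div_iff₀ hc]
      nlinarith [hz1 n]
    linarith
  refine ⟨?_, hzt⟩
  have hxt : Tendsto (fun n => z n / (1 - z n) / L n ^ d) atTop (nhds (ρ - ρc)) := by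
    simp_rw [hx]
    exact hdens.sub (key d hd β hβ L hLpos hL z hz0 (fun n => (hz1 n).le) hzt)
  refine (hzt.div hxt (by linarith)).congr fun n => ?_
  have h1 : 1 - z n ≠ 0 := by linarith [hz1 n]
  have h2 := (hLd n).ne'
  have h3 := (hz0 n).ne'
  simp only [Pi.div_apply]
  field_simp
end
end

section
/- For all sufficiently large L, L^d (1 − g̃₀(L)) ≤ ‖1 − e^{−f}‖₁, and moreover liminf_{L→∞} L^d (1 − g̃₀(L)) ≥ ‖1 − e^{−f}‖₁ / (1 + ρ_c ‖1 − e^{−f}‖₁); that is, L^d(g₀(L) − g̃₀(L)) ∈ [ ‖1−e^{−f}‖₁ (1+o(1)) / (1 + ρ_c‖1−e^{−f}‖₁), ‖1−e^{−f}‖₁ ] with g₀(L) = 1. -/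
open MeasureTheory Filter
open scoped ENNReal NNReal

noncomputable section

/-- the box `Λ_L = [-L/2, L/2]^d`. -/
def box (d : ℕ) (L : ℝ) : Set (EuclideanSpace ℝ (Fin d)) :=
  {x | ∀ i, |x i| ≤ L / 2}

/-- the integral kernel of `G_L^{1/2} = e^{(β/2)Δ_L}` with periodic boundary
conditions on `Λ_L`:
`L^{-d} Σ_{k∈ℤ^d} e^{-(β/2)|2πk/L|²} e^{i2πk·(x-y)/L}`. -/
def heatHalfKer (d : ℕ) (β L : ℝ) (x y : EuclideanSpace ℝ (Fin d)) : ℂ :=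
  (∑' k : Fin d → ℤ,
      Complex.exp (((-(β / 2) * ∑ i, (2 * Real.pi * (k i : ℝ) / L) ^ 2 : ℝ) : ℂ) +
        Complex.I * ((2 * Real.pi * (∑ i, (k i : ℝ) * (x i - y i)) / L : ℝ) : ℂ))) / (L : ℂ) ^ d

/-- the integral kernel of `G̃_L = G_L^{1/2} e^{-f} G_L^{1/2}` on `L²(Λ_L)`. -/
def tildeGKer (d : ℕ) (β L : ℝ) (f : EuclideanSpace ℝ (Fin d) → ℝ)
    (x y : EuclideanSpace ℝ (Fin d)) : ℂ :=
  ∫ z, heatHalfKer d β L x z * ((Real.exp (-f z) : ℝ) : ℂ) * heatHalfKer d β L z y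
    ∂((volume : Measure (EuclideanSpace ℝ (Fin d))).restrict (box d L))

/-- `A` has integral kernel `k` on `L²(μ)`. -/
def IsKernelOfC {E : Type*} [MeasurableSpace E] (μ : Measure E)
    (A : Lp ℂ 2 μ →L[ℂ] Lp ℂ 2 μ) (k : E → E → ℂ) : Prop :=
  ∀ φ : Lp ℂ 2 μ, ∀ᵐ x ∂μ, (A φ : E → ℂ) x = ∫ y, k x y * (φ : E → ℂ) y ∂μ


/-- the Bose function as a function of the radius -/
def boseR (β r : ℝ) : ℝ := Real.exp (-β * r ^ 2) / (1 - Real.exp (-β * r ^ 2))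

lemma boseR_eq {β r : ℝ} : boseR β r = 1 / (Real.exp (β * r ^ 2) - 1) := by
  unfold boseR
  have h := Real.exp_pos (β * r ^ 2)
  rw [show -β * r ^ 2 = -(β * r ^ 2) by ring, Real.exp_neg]
  by_cases h1 : Real.exp (β * r ^ 2) = 1
  · simp [h1]
  · have h2 : Real.exp (β * r ^ 2) - 1 ≠ 0 := sub_ne_zero.2 h1
    have h3 : 1 - (Real.exp (β * r ^ 2))⁻¹ ≠ 0 := by
      intro h4
      apply h1
      field_simp at h4
      linarith
    field_simp

lemma boseR_nonneg {β : ℝ} (hβ : 0 < β) (r : ℝ) : 0 ≤ boseR β r := by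
  rw [boseR_eq]
  have : 1 ≤ Real.exp (β * r ^ 2) := Real.one_le_exp (by positivity)
  apply div_nonneg zero_le_one; linarith

lemma boseR_anti {β : ℝ} (hβ : 0 < β) {r s : ℝ} (hr : 0 < r) (hrs : r ≤ s) :
    boseR β s ≤ boseR β r := by
  rw [boseR_eq, boseR_eq]
  have : 1 < Real.exp (β * r ^ 2) := by
    apply Real.one_lt_exp_iff.2; positivity
  apply one_div_le_one_div_of_le (by linarith)
  gcongr

lemma boseR_measurable (β : ℝ) : Measurable (boseR β) := by
  unfold boseR; fun_prop

lemma boseR_zero (β : ℝ) : boseR β 0 = 0 := by simp [boseR]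

lemma boseR_contAt {β : ℝ} (hβ : 0 < β) {r : ℝ} (hr : 0 < r) : ContinuousAt (boseR β) r := by
  unfold boseR
  apply ContinuousAt.div (by fun_prop) (by fun_prop)
  have : Real.exp (-β * r ^ 2) < 1 := by
    apply Real.exp_lt_one_iff.2
    have : 0 < β * r^2 := by positivity
    linarith
  linarith

lemma bose_integrable (d : ℕ) (hd : 2 < d) {β : ℝ} (hβ : 0 < β) :
    Integrable (fun p : EuclideanSpace ℝ (Fin d) => boseR β ‖p‖) := by
  have : Nonempty (Fin d) := ⟨⟨0, by omega⟩⟩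
  rw [integrable_fun_norm_addHaar]
  have hdim : Module.finrank ℝ (EuclideanSpace ℝ (Fin d)) = d := by simp
  rw [hdim, ← Set.Ioc_union_Ioi_eq_Ioi (zero_le_one' ℝ)]
  apply IntegrableOn.union
  · apply Measure.integrableOn_of_bounded (M := 1 / β) (by simp)
    · exact ((measurable_id.pow_const _).smul (boseR_measurable β)).aestronglyMeasurable
    · refine (ae_restrict_iff' measurableSet_Ioc).2 (ae_of_all _ ?_)
      intro r hr
      rw [smul_eq_mul, Real.norm_of_nonneg (mul_nonneg (pow_nonneg hr.1.le _) (boseR_nonneg hβ r)),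
        boseR_eq]
      have h1 : β * r ^ 2 ≤ Real.exp (β * r ^ 2) - 1 := by
        linarith [Real.add_one_le_exp (β * r ^ 2)]
      have hr0 := hr.1
      calc r ^ (d - 1) * (1 / (Real.exp (β * r ^ 2) - 1))
          ≤ r ^ 2 * (1 / (β * r ^ 2)) := by
            apply mul_le_mul (pow_le_pow_of_le_one hr.1.le hr.2 (by omega)) _ _ (by positivity)
            · exact one_div_le_one_div_of_le (by positivity) h1
            · apply one_div_nonneg.2
              exact le_trans (by positivity) h1
        _ = 1 / β := by field_simp
  · have hI : IntegrableOn (fun r : ℝ => (Nat.factorial d / β ^ d) * r ^ (-2 : ℝ)) (Set.Ioi 1) :=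
      (integrableOn_Ioi_rpow_of_lt (by norm_num) zero_lt_one).const_mul _
    refine hI.mono' ?_ ?_
    · exact ((measurable_id.pow_const _).smul (boseR_measurable β)).aestronglyMeasurable
    · refine (ae_restrict_iff' measurableSet_Ioi).2 (ae_of_all _ ?_)
      intro r hr
      have hr1 : (1:ℝ) < r := hr
      have hr0 : 0 < r := by linarith
      rw [smul_eq_mul, Real.norm_of_nonneg (mul_nonneg (pow_nonneg hr0.le _) (boseR_nonneg hβ r)),
        boseR_eq]
      have h1 : (β * r ^ 2) ^ d / Nat.factorial d ≤ Real.exp (β * r ^ 2) - 1 := by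
        have := Real.sum_le_exp_of_nonneg (x := β * r ^ 2) (by positivity) (d + 1)
        rw [Finset.sum_range_succ] at this
        have h2 : 1 ≤ ∑ i ∈ Finset.range d, (β * r ^ 2) ^ i / (Nat.factorial i : ℝ) := by
          have := Finset.single_le_sum (f := fun i => (β * r ^ 2) ^ i / (Nat.factorial i : ℝ))
            (s := Finset.range d) (fun i _ => by positivity)
            (Finset.mem_range.2 (by omega : 0 < d))
          simpa using this
        linarith
      calc r ^ (d - 1) * (1 / (Real.exp (β * r ^ 2) - 1))
          ≤ r ^ (d - 1) * (1 / ((β * r ^ 2) ^ d / Nat.factorial d)) := by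
            gcongr
        _ = (Nat.factorial d / β ^ d) * (r ^ (d - 1) / (r ^ 2) ^ d) := by
            rw [mul_pow]; field_simp
        _ ≤ (Nat.factorial d / β ^ d) * r ^ (-2 : ℝ) := by
            gcongr
            rw [Real.rpow_neg hr0.le, Real.rpow_ofNat, div_le_iff₀ (by positivity), ← pow_mul,
              inv_mul_eq_div, le_div_iff₀ (by positivity), ← pow_add]
            exact pow_le_pow_right₀ hr1.le (by omega)

/-- lattice momentum -/
def latPt (d : ℕ) (L : ℝ) (k : Fin d → ℤ) : EuclideanSpace ℝ (Fin d) :=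
  WithLp.toLp 2 (fun i => 2 * Real.pi * (k i : ℝ) / L)

/-- rounding to the lattice -/
def latRound (d : ℕ) (L : ℝ) (p : EuclideanSpace ℝ (Fin d)) : Fin d → ℤ :=
  fun i => ⌊p i * L / (2 * Real.pi) + 1 / 2⌋

lemma latRound_measurable (d : ℕ) (L : ℝ) : Measurable (latRound d L) := by
  unfold latRound
  refine measurable_pi_lambda _ (fun i => ?_)
  apply Int.measurable_floor.comp
  fun_prop

lemma latRound_close (d : ℕ) {L : ℝ} (hL : 0 < L) (p : EuclideanSpace ℝ (Fin d)) (i : Fin d) :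
    |p i * L / (2 * Real.pi) - latRound d L p i| ≤ 1 / 2 := by
  unfold latRound
  have h1 := Int.floor_le (p i * L / (2 * Real.pi) + 1 / 2)
  have h2 := Int.lt_floor_add_one (p i * L / (2 * Real.pi) + 1 / 2)
  rw [abs_le]; constructor <;> linarith

lemma latRound_dom (d : ℕ) {L : ℝ} (hL : 0 < L) (p : EuclideanSpace ℝ (Fin d))
    (h : latRound d L p ≠ 0) :
    2 / Real.sqrt (9 + d) * ‖p‖ ≤ ‖latPt d L (latRound d L p)‖ := by
  set k := latRound d L p with hk
  have hsum1 : (1:ℝ) ≤ ∑ i, (k i : ℝ) ^ 2 := by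
    obtain ⟨i, hi⟩ := Function.ne_iff.1 h
    have : (1:ℝ) ≤ (k i : ℝ) ^ 2 := by
      have : (1:ℤ) ≤ (k i) ^ 2 := by
        have := sq_nonneg (k i)
        have h3 : (k i)^2 ≠ 0 := pow_ne_zero _ hi
        omega
      exact_mod_cast this
    exact this.trans (Finset.single_le_sum (f := fun i => (k i : ℝ) ^ 2) (fun i _ => sq_nonneg _)
      (Finset.mem_univ i))
  have hpi := Real.pi_pos
  have hcoord : ∀ i, (p i) ^ 2 ≤ (2 * Real.pi / L) ^ 2 * (9 / 4 * (k i : ℝ) ^ 2 + 1 / 4) := by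
    intro i
    have h1 := latRound_close d hL p i
    rw [← hk] at h1
    set y := p i * L / (2 * Real.pi) with hy
    have hp : p i = (2 * Real.pi / L) * y := by rw [hy]; field_simp
    rw [hp, mul_pow]
    gcongr
    rw [abs_le] at h1
    by_cases h0 : k i = 0
    · rw [h0] at h1 ⊢
      norm_num at h1 ⊢
      nlinarith
    · rcases lt_or_gt_of_ne h0 with h2 | h2
      · have : (k i : ℝ) ≤ -1 := by exact_mod_cast (by omega : k i ≤ -1)
        nlinarith
      · have : (1 : ℝ) ≤ k i := by exact_mod_cast (by omega : 1 ≤ k i)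
        nlinarith
  have hP : ‖p‖ ^ 2 ≤ (9 + d) / 4 * ‖latPt d L k‖ ^ 2 := by
    rw [EuclideanSpace.norm_sq_eq, EuclideanSpace.norm_sq_eq]
    have e1 : ∑ i, ‖latPt d L k i‖ ^ 2 = (2 * Real.pi / L) ^ 2 * ∑ i, (k i : ℝ) ^ 2 := by
      rw [Finset.mul_sum]
      refine Finset.sum_congr rfl (fun i _ => ?_)
      simp only [latPt, Real.norm_eq_abs, sq_abs]; ring
    rw [e1]
    calc ∑ i, ‖p i‖ ^ 2 ≤ ∑ i, (2 * Real.pi / L) ^ 2 * (9 / 4 * (k i : ℝ) ^ 2 + 1 / 4) := by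
          refine Finset.sum_le_sum (fun i _ => ?_)
          rw [Real.norm_eq_abs, sq_abs]; exact hcoord i
      _ = (2 * Real.pi / L) ^ 2 * (9 / 4 * ∑ i, (k i : ℝ) ^ 2 + d / 4 * 1) := by
          rw [← Finset.mul_sum, Finset.sum_add_distrib, ← Finset.mul_sum]
          simp; left; ring
      _ ≤ (2 * Real.pi / L) ^ 2 * (9 / 4 * ∑ i, (k i : ℝ) ^ 2 + d / 4 * ∑ i, (k i : ℝ) ^ 2) := by
          gcongr
      _ = _ := by ring
  have h9 : (0:ℝ) < 9 + d := by positivity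
  apply le_of_sq_le_sq _ (norm_nonneg _)
  rw [mul_pow, div_pow, Real.sq_sqrt h9.le, div_mul_eq_mul_div, div_le_iff₀ h9]
  linarith

/-- the step function approximating the Bose function -/
def boseStep (d : ℕ) (β L : ℝ) (p : EuclideanSpace ℝ (Fin d)) : ℝ :=
  boseR β ‖latPt d L (latRound d L p)‖

lemma boseStep_measurable (d : ℕ) (β L : ℝ) : Measurable (boseStep d β L) := by
  have : Measurable (fun k : Fin d → ℤ => boseR β ‖latPt d L k‖) := measurable_of_countable _
  exact this.comp (latRound_measurable d L)

lemma boseStep_le (d : ℕ) {β : ℝ} (hβ : 0 < β) {L : ℝ} (hL : 0 < L)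
    (p : EuclideanSpace ℝ (Fin d)) (hp : p ≠ 0) :
    boseStep d β L p ≤ boseR β ‖(2 / Real.sqrt (9 + d)) • p‖ := by
  unfold boseStep
  have h9 : (0:ℝ) < 9 + d := by positivity
  by_cases h : latRound d L p = 0
  · rw [h]
    have : latPt d L 0 = 0 := by ext i; simp [latPt]
    rw [this, norm_zero, boseR_zero]
    exact boseR_nonneg hβ _
  · rw [norm_smul, Real.norm_of_nonneg (by positivity)]
    have : 0 < ‖p‖ := norm_pos_iff.2 hp
    exact boseR_anti hβ (by positivity) (latRound_dom d hL p h)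

lemma bose_dom_integrable (d : ℕ) (hd : 2 < d) {β : ℝ} (hβ : 0 < β) :
    Integrable (fun p : EuclideanSpace ℝ (Fin d) => boseR β ‖(2 / Real.sqrt (9 + d)) • p‖) := by
  have h9 : (0:ℝ) < 9 + d := by positivity
  exact (bose_integrable d hd hβ).comp_smul (R := 2 / Real.sqrt (9 + d)) (by positivity)

lemma ae_ne_zero (d : ℕ) (hd : 2 < d) : ∀ᵐ p : EuclideanSpace ℝ (Fin d), p ≠ 0 := by
  have : Nonempty (Fin d) := ⟨⟨0, by omega⟩⟩
  have : Nontrivial (EuclideanSpace ℝ (Fin d)) := by infer_instance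
  exact Measure.ae_ne volume 0

lemma boseStep_integrable (d : ℕ) (hd : 2 < d) {β : ℝ} (hβ : 0 < β) {L : ℝ} (hL : 0 < L) :
    Integrable (boseStep d β L) := by
  refine (bose_dom_integrable d hd hβ).mono' (boseStep_measurable d β L).aestronglyMeasurable ?_
  filter_upwards [ae_ne_zero d hd] with p hp
  rw [Real.norm_of_nonneg (show 0 ≤ boseStep d β L p from boseR_nonneg hβ _)]
  exact boseStep_le d hβ hL p hp

lemma latPt_tendsto (d : ℕ) (p : EuclideanSpace ℝ (Fin d)) :
    Tendsto (fun L : ℝ => latPt d L (latRound d L p)) atTop (nhds p) := by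
  have h : Tendsto (fun L : ℝ => (WithLp.ofLp (latPt d L (latRound d L p)))) atTop
      (nhds (WithLp.ofLp p)) := by
    rw [tendsto_pi_nhds]
    intro i
    have hz : Tendsto (fun L : ℝ => Real.pi / L) atTop (nhds 0) :=
      tendsto_const_nhds.div_atTop tendsto_id
    rw [tendsto_iff_dist_tendsto_zero]
    refine squeeze_zero' (Eventually.of_forall fun _ => dist_nonneg) ?_ hz
    filter_upwards [eventually_gt_atTop 0] with L hL
    have h1 := latRound_close d hL p i
    have hpi := Real.pi_pos
    rw [Real.dist_eq, abs_sub_comm]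
    have : p i - 2 * Real.pi * (latRound d L p i : ℝ) / L =
        (2 * Real.pi / L) * (p i * L / (2 * Real.pi) - latRound d L p i) := by
      field_simp
    simp only [latPt]
    rw [this, abs_mul, abs_of_pos (by positivity)]
    calc _ ≤ (2 * Real.pi / L) * (1 / 2) := by gcongr
      _ = _ := by ring
  have := ((PiLp.continuous_toLp 2 (fun _ : Fin d => ℝ)).tendsto (WithLp.ofLp p)).comp h
  simpa [Function.comp_def] using this

lemma boseStep_tendsto (d : ℕ) (hd : 2 < d) {β : ℝ} (hβ : 0 < β) :
    Tendsto (fun L : ℝ => ∫ p, boseStep d β L p) atTop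
      (nhds (∫ p : EuclideanSpace ℝ (Fin d), boseR β ‖p‖)) := by
  apply tendsto_integral_filter_of_dominated_convergence _ _ _ (bose_dom_integrable d hd hβ)
  · filter_upwards [ae_ne_zero d hd] with p hp
    have h1 := (latPt_tendsto d p).norm
    exact (boseR_contAt hβ (norm_pos_iff.2 hp)).tendsto.comp h1
  · exact Eventually.of_forall fun L => (boseStep_measurable d β L).aestronglyMeasurable
  · filter_upwards [eventually_gt_atTop 0] with L hL
    filter_upwards [ae_ne_zero d hd] with p hp
    rw [Real.norm_of_nonneg (show 0 ≤ boseStep d β L p from boseR_nonneg hβ _)]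
    exact boseStep_le d hβ hL p hp

lemma volume_cell (d : ℕ) {L : ℝ} (hL : 0 < L) (k : Fin d → ℤ) :
    volume (latRound d L ⁻¹' {k}) = ENNReal.ofReal ((2 * Real.pi / L) ^ d) := by
  have hpi := Real.pi_pos
  have hset : latRound d L ⁻¹' {k} = (@WithLp.ofLp 2 (Fin d → ℝ)) ⁻¹'
      (Set.pi Set.univ fun i => Set.Ico ((2 * Real.pi / L) * ((k i : ℝ) - 1 / 2))
        ((2 * Real.pi / L) * ((k i : ℝ) + 1 / 2))) := by
    ext p
    simp only [Set.mem_preimage, Set.mem_singleton_iff, Set.mem_pi, Set.mem_univ, true_imp_iff,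
      funext_iff, latRound, Int.floor_eq_iff, Set.mem_Ico]
    refine forall_congr' fun i => ?_
    have hp : p i = (2 * Real.pi / L) * (p i * L / (2 * Real.pi)) := by field_simp
    have hc : 0 < 2 * Real.pi / L := by positivity
    generalize p i * L / (2 * Real.pi) = y at hp
    rw [hp, mul_le_mul_iff_right₀ hc, mul_lt_mul_iff_right₀ hc]
    constructor <;> rintro ⟨h1, h2⟩ <;> constructor <;> linarith
  rw [hset, (PiLp.volume_preserving_ofLp (Fin d)).measure_preimage
    (MeasurableSet.univ_pi fun i => measurableSet_Ico).nullMeasurableSet, Real.volume_pi_Ico]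
  have : ∀ i : Fin d, (2 * Real.pi / L) * ((k i : ℝ) + 1 / 2) -
    (2 * Real.pi / L) * ((k i : ℝ) - 1 / 2) = 2 * Real.pi / L := fun i => by ring
  simp only [this, Finset.prod_const, Finset.card_univ, Fintype.card_fin]
  rw [ENNReal.ofReal_pow (by positivity)]

lemma bose_sum_le (d : ℕ) (hd : 2 < d) {β : ℝ} (hβ : 0 < β) {L : ℝ} (hL : 0 < L)
    (F : Finset (Fin d → ℤ)) :
    ∑ k ∈ F, boseR β ‖latPt d L k‖ ≤ (∫ p, boseStep d β L p) / (2 * Real.pi / L) ^ d := by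
  have hpi := Real.pi_pos
  rw [le_div_iff₀ (by positivity), Finset.sum_mul]
  have hm : ∀ k, MeasurableSet (latRound d L ⁻¹' {k}) := fun k =>
    latRound_measurable d L (measurableSet_singleton k)
  have hindI : ∀ k, Integrable ((latRound d L ⁻¹' {k}).indicator
      (fun _ : EuclideanSpace ℝ (Fin d) => boseR β ‖latPt d L k‖)) := by
    intro k
    rw [integrable_indicator_iff (hm k)]
    apply integrableOn_const
    · rw [volume_cell d hL k]; exact ENNReal.ofReal_ne_top
    · simp
  calc ∑ k ∈ F, boseR β ‖latPt d L k‖ * (2 * Real.pi / L) ^ d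
      = ∑ k ∈ F, ∫ p, (latRound d L ⁻¹' {k}).indicator
          (fun _ : EuclideanSpace ℝ (Fin d) => boseR β ‖latPt d L k‖) p := by
        refine Finset.sum_congr rfl fun k _ => ?_
        rw [integral_indicator_const _ (hm k), measureReal_def, volume_cell d hL k,
          ENNReal.toReal_ofReal (by positivity), smul_eq_mul, mul_comm]
    _ = ∫ p, ∑ k ∈ F, (latRound d L ⁻¹' {k}).indicator
          (fun _ : EuclideanSpace ℝ (Fin d) => boseR β ‖latPt d L k‖) p := by
        rw [integral_finsetSum _ fun k _ => hindI k]
    _ ≤ _ := by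
        apply integral_mono (integrable_finsetSum _ fun k _ => hindI k)
          (boseStep_integrable d hd hβ hL)
        intro p
        have e : ∀ k ∈ F, (latRound d L ⁻¹' {k}).indicator
            (fun _ : EuclideanSpace ℝ (Fin d) => boseR β ‖latPt d L k‖) p =
            if latRound d L p = k then boseR β ‖latPt d L k‖ else 0 := by
          intro k _
          by_cases h : latRound d L p = k <;> simp [Set.indicator, h]
        beta_reduce
        rw [Finset.sum_congr rfl e, Finset.sum_ite_eq]
        split_ifs
        · exact le_rfl
        · exact boseR_nonneg hβ _

section abstractHilbert

variable {E ι : Type*} [NormedAddCommGroup E] [InnerProductSpace ℂ E]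

lemma hilb_hasSum_sq {u : ι → E} (hu : Orthonormal ℂ u) (b : ι → ℂ) (ψ : E)
    (hψ : HasSum (fun k => b k • u k) ψ) : HasSum (fun k => ‖b k‖ ^ 2) (‖ψ‖ ^ 2) := by
  classical
  have h1 : ∀ j, inner ℂ (u j) ψ = b j := by
    intro j
    have h := hψ.mapL (innerSL ℂ (u j))
    have h2 : HasSum (fun k => (innerSL ℂ (u j)) (b k • u k)) (b j) := by
      convert! hasSum_ite_eq j (b j) using 2 with k
      simp only [innerSL_apply_apply, inner_smul_right, orthonormal_iff_ite.1 hu j k]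
      by_cases hjk : j = k
      · simp [hjk]
      · simp [hjk, Ne.symm hjk]
    exact h.unique h2
  have h := hψ.mapL (innerSL ℂ ψ)
  have h3 : HasSum (fun k => ((‖b k‖ ^ 2 : ℝ) : ℂ)) ((‖ψ‖ ^ 2 : ℝ) : ℂ) := by
    convert! h using 2 with k
    · simp only [innerSL_apply_apply, inner_smul_right]
      rw [← inner_conj_symm, h1, Complex.mul_conj, Complex.normSq_eq_norm_sq]
    · simp [inner_self_eq_norm_sq_to_K]
  exact_mod_cast h3

lemma hilb_main {u : ι → E} (hu : Orthonormal ℂ u) (a : ι → ℝ) (i0 : ι) (ha0 : a i0 = 1)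
    (γ : ℝ) (hγ : 0 < γ) (hγ1 : γ ≤ 1) (hag : ∀ k, k ≠ i0 → a k ^ 2 ≤ 1 - γ)
    (R : ℝ) (hR : ∀ F : Finset ι, i0 ∉ F → ∑ k ∈ F, a k ^ 2 / (1 - a k ^ 2) ≤ R)
    (w : E →L[ℂ] ℂ) (N l : ℝ) (hN : 0 < N) (hl : 0 < l) (hw : ∀ k, ‖w (u k)‖ ≤ N * l)
    (hw0 : ‖w (u i0)‖ = N * l) (φ ψ : E)
    (hψ : HasSum (fun k => ((a k : ℂ) * inner ℂ (u k) φ) • u k) ψ)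
    (Q : ℝ) (hQ0 : 0 ≤ Q) (hQ : ‖w ψ‖ ^ 2 ≤ N * Q) :
    γ * (‖φ‖ ^ 2 - ‖inner ℂ (u i0) φ‖ ^ 2) ≤ ‖φ‖ ^ 2 - ‖ψ‖ ^ 2 + Q ∧
    ‖inner ℂ (u i0) φ‖ ^ 2 * (N * l ^ 2) ≤
      (1 + N * (l ^ 2 * R)) * (‖φ‖ ^ 2 - ‖ψ‖ ^ 2 + Q) := by
  classical
  set c : ι → ℂ := fun k => inner ℂ (u k) φ with hc
  change γ * (‖φ‖ ^ 2 - ‖c i0‖ ^ 2) ≤ _ ∧ ‖c i0‖ ^ 2 * (N * l ^ 2) ≤ _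
  have hB : ∀ F : Finset ι, ∑ k ∈ F, ‖c k‖ ^ 2 ≤ ‖φ‖ ^ 2 := fun F =>
    hu.sum_inner_products_le φ
  have hS : HasSum (fun k => a k ^ 2 * ‖c k‖ ^ 2) (‖ψ‖ ^ 2) := by
    have := hilb_hasSum_sq hu _ ψ hψ
    convert! this using 2 with k
    simp [mul_pow, hc]
  have hR0 : 0 ≤ R := by simpa using hR ∅ (by simp)
  -- finite version of the gap
  have hFin : ∀ F : Finset ι, i0 ∈ F →
      ∑ k ∈ F.erase i0, (1 - a k ^ 2) * ‖c k‖ ^ 2 ≤ ‖φ‖ ^ 2 - ∑ k ∈ F, a k ^ 2 * ‖c k‖ ^ 2 := by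
    intro F hF
    have h1 := hB F
    rw [← Finset.add_sum_erase F _ hF] at h1 ⊢
    simp only [sub_mul, one_mul, Finset.sum_sub_distrib]
    rw [ha0]; linarith
  have hev : ∀ᶠ F : Finset ι in atTop, i0 ∈ F := by
    filter_upwards [eventually_ge_atTop {i0}] with F hF
    exact hF (by simp)
  have hD1 : γ * (‖φ‖ ^ 2 - ‖c i0‖ ^ 2) ≤ ‖φ‖ ^ 2 - ‖ψ‖ ^ 2 := by
    refine ge_of_tendsto (tendsto_const_nhds.sub hS) ?_
    filter_upwards [hev] with F hF
    have h1 := hB F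
    rw [← Finset.add_sum_erase F _ hF] at h1 ⊢
    have h2 : ∑ k ∈ F.erase i0, a k ^ 2 * ‖c k‖ ^ 2 ≤
        (1 - γ) * ∑ k ∈ F.erase i0, ‖c k‖ ^ 2 := by
      rw [Finset.mul_sum]
      refine Finset.sum_le_sum fun k hk => ?_
      have := hag k (Finset.ne_of_mem_erase hk)
      gcongr
    have h3 : (1 - γ) * ∑ k ∈ F.erase i0, ‖c k‖ ^ 2 ≤ (1 - γ) * (‖φ‖ ^ 2 - ‖c i0‖ ^ 2) := by
      apply mul_le_mul_of_nonneg_left _ (by linarith)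
      linarith
    rw [ha0]; linarith
  have hD0 : 0 ≤ ‖φ‖ ^ 2 - ‖ψ‖ ^ 2 := by
    have := hB {i0}
    rw [Finset.sum_singleton] at this
    exact le_trans (mul_nonneg hγ.le (by linarith)) hD1
  refine ⟨by linarith, ?_⟩
  set D := ‖φ‖ ^ 2 - ‖ψ‖ ^ 2 with hD
  have hwS : HasSum (fun k => ((a k : ℂ) * c k) * w (u k)) (w ψ) := by
    have := hψ.mapL w
    simpa using this
  have hZ : ‖w ψ - c i0 * w (u i0)‖ ^ 2 ≤ D * (R * (N * l) ^ 2) := by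
    have t1 : Tendsto (fun F : Finset ι => ‖∑ k ∈ F, ((a k : ℂ) * c k) * w (u k) -
        c i0 * w (u i0)‖ ^ 2) atTop (nhds (‖w ψ - c i0 * w (u i0)‖ ^ 2)) :=
      ((Tendsto.sub_const hwS _).norm).pow 2
    have t2 : Tendsto (fun F : Finset ι => (‖φ‖ ^ 2 - ∑ k ∈ F, a k ^ 2 * ‖c k‖ ^ 2) *
        (R * (N * l) ^ 2)) atTop (nhds (D * (R * (N * l) ^ 2))) :=
      (tendsto_const_nhds.sub hS).mul_const _
    refine le_of_tendsto_of_tendsto t1 t2 ?_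
    filter_upwards [hev] with F hF
    have e1 : ∑ k ∈ F, ((a k : ℂ) * c k) * w (u k) - c i0 * w (u i0) =
        ∑ k ∈ F.erase i0, ((a k : ℂ) * c k) * w (u k) := by
      rw [← Finset.add_sum_erase F _ hF, ha0]; simp
    rw [e1]
    have hpos : ∀ k ∈ F.erase i0, 0 < 1 - a k ^ 2 := fun k hk => by
      linarith [hag k (Finset.ne_of_mem_erase hk)]
    have n1 : ‖∑ k ∈ F.erase i0, ((a k : ℂ) * c k) * w (u k)‖ ≤
        ∑ k ∈ F.erase i0, (Real.sqrt (1 - a k ^ 2) * ‖c k‖) *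
          ((|a k| / Real.sqrt (1 - a k ^ 2)) * (N * l)) := by
      refine (norm_sum_le _ _).trans (Finset.sum_le_sum fun k hk => ?_)
      have hs : 0 < Real.sqrt (1 - a k ^ 2) := Real.sqrt_pos.2 (hpos k hk)
      rw [norm_mul, norm_mul, Complex.norm_real, Real.norm_eq_abs]
      calc |a k| * ‖c k‖ * ‖w (u k)‖ ≤ |a k| * ‖c k‖ * (N * l) := by gcongr; exact hw k
        _ = _ := by field_simp
    have n2 := Finset.sum_mul_sq_le_sq_mul_sq (F.erase i0)
      (fun k => Real.sqrt (1 - a k ^ 2) * ‖c k‖)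
      (fun k => (|a k| / Real.sqrt (1 - a k ^ 2)) * (N * l))
    have m1 : ∑ k ∈ F.erase i0, (Real.sqrt (1 - a k ^ 2) * ‖c k‖) ^ 2 =
        ∑ k ∈ F.erase i0, (1 - a k ^ 2) * ‖c k‖ ^ 2 := by
      refine Finset.sum_congr rfl fun k hk => ?_
      rw [mul_pow, Real.sq_sqrt (hpos k hk).le]
    have m2 : ∑ k ∈ F.erase i0, ((|a k| / Real.sqrt (1 - a k ^ 2)) * (N * l)) ^ 2 =
        (∑ k ∈ F.erase i0, a k ^ 2 / (1 - a k ^ 2)) * (N * l) ^ 2 := by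
      rw [Finset.sum_mul]
      refine Finset.sum_congr rfl fun k hk => ?_
      rw [mul_pow, div_pow, Real.sq_sqrt (hpos k hk).le, sq_abs]
    rw [m1, m2] at n2
    calc _ ≤ _ := pow_le_pow_left₀ (norm_nonneg _) n1 2
      _ ≤ _ := n2
      _ ≤ _ := by
        apply mul_le_mul (hFin F hF)
        · gcongr
          exact hR _ (by simp)
        · apply mul_nonneg _ (by positivity)
          exact Finset.sum_nonneg fun k hk => div_nonneg (sq_nonneg _) (hpos k hk).le
        · refine le_trans ?_ (hFin F hF)
          exact Finset.sum_nonneg fun k hk => mul_nonneg (hpos k hk).le (sq_nonneg _)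
  set X := ‖w ψ‖ with hX
  set Z := ‖w ψ - c i0 * w (u i0)‖ with hZd
  have hX0 : 0 ≤ X := norm_nonneg _
  have hZ0 : 0 ≤ Z := norm_nonneg _
  have tri : ‖c i0‖ * (N * l) ≤ X + Z := by
    rw [← hw0, ← norm_mul]
    calc ‖c i0 * w (u i0)‖ = ‖w ψ - (w ψ - c i0 * w (u i0))‖ := by congr 1; ring
      _ ≤ _ := norm_sub_le _ _
  have hXZ : 2 * (X * Z) ≤ N * (Q * (N * l ^ 2 * R) + D) := by
    apply le_of_sq_le_sq _ (by positivity)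
    have : X ^ 2 * Z ^ 2 ≤ (N * Q) * (D * (R * (N * l) ^ 2)) := by
      apply mul_le_mul hQ hZ (by positivity) (by positivity)
    have h4 : 0 ≤ N ^ 2 * (Q * (N * l ^ 2 * R) - D) ^ 2 := by positivity
    nlinarith
  have key : (‖c i0‖ * (N * l)) ^ 2 ≤ (X + Z) ^ 2 := by
    apply pow_le_pow_left₀ (by positivity) tri
  have fin : N * (‖c i0‖ ^ 2 * (N * l ^ 2)) ≤ N * ((1 + N * (l ^ 2 * R)) * (D + Q)) := by
    nlinarith
  exact le_of_mul_le_mul_left fin hN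

end abstractHilbert

lemma opNorm_le_of_form {E : Type*} [NormedAddCommGroup E] [InnerProductSpace ℂ E]
    (T : E →L[ℂ] E) (B : ℝ) (hB : 0 ≤ B)
    (h : ∀ x y : E, ‖x‖ = 1 → ‖y‖ = 1 → ‖inner ℂ x (T y)‖ ≤ B) : ‖T‖ ≤ B := by
  refine ContinuousLinearMap.opNorm_le_of_re_inner_le hB fun x y hx hy => ?_
  rw [← inner_conj_symm]
  have := h y x hy hx
  refine le_trans (RCLike.re_le_norm _) ?_
  rwa [RCLike.norm_conj]

section abstractKernel

open BoundedContinuousFunction ComplexConjugate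

variable {X ι : Type*} [TopologicalSpace X] [SecondCountableTopology X]
  [MeasurableSpace X] [BorelSpace X] (μ : Measure X) [IsFiniteMeasure μ]

/-- class in `L²` of a bounded continuous function -/
abbrev bcL (U : X →ᵇ ℂ) : Lp ℂ 2 μ := BoundedContinuousFunction.toLp 2 μ ℂ U

lemma bcL_coe (U : X →ᵇ ℂ) : (bcL μ U : X → ℂ) =ᵐ[μ] U :=
  BoundedContinuousFunction.coeFn_toLp 2 μ ℂ U

lemma Lp2_integrable (φ : Lp ℂ 2 μ) : Integrable (φ : X → ℂ) μ :=
  (Lp.memLp φ).integrable (by norm_num)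

lemma inner_bcL (U : X →ᵇ ℂ) (φ : Lp ℂ 2 μ) :
    inner ℂ (bcL μ U) φ = ∫ y, conj (U y) * (φ : X → ℂ) y ∂μ := by
  rw [L2.inner_def]
  refine integral_congr_ae ?_
  filter_upwards [bcL_coe μ U] with y hy
  rw [hy, RCLike.inner_apply, mul_comm]

lemma inner_bcL_bcL (U V : X →ᵇ ℂ) :
    inner ℂ (bcL μ U) (bcL μ V) = ∫ y, conj (U y) * V y ∂μ := by
  rw [inner_bcL]
  refine integral_congr_ae ?_
  filter_upwards [bcL_coe μ V] with y hy
  rw [hy]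

lemma norm_bcL_sq (U : X →ᵇ ℂ) : ‖bcL μ U‖ ^ 2 = ∫ y, ‖U y‖ ^ 2 ∂μ := by
  have h := inner_bcL_bcL μ U U
  rw [inner_self_eq_norm_sq_to_K] at h
  have h2 : ∫ y, conj (U y) * U y ∂μ = ((∫ y, ‖U y‖ ^ 2 ∂μ : ℝ) : ℂ) := by
    rw [← integral_complex_ofReal]
    refine integral_congr_ae (ae_of_all _ fun y => ?_)
    simp [RCLike.conj_mul]
  rw [h2] at h
  apply Complex.ofReal_injective
  rw [← h]; simp

lemma bc_integrable (U : X →ᵇ ℂ) : Integrable (fun x => U x) μ := U.integrable μ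

/-- the function `Σ a_k ⟨u_k, φ⟩ U_k`. -/
def psiB (U : ι → X →ᵇ ℂ) (a : ι → ℝ) (φ : Lp ℂ 2 μ) : X →ᵇ ℂ :=
  ∑' k, ((a k : ℂ) * inner ℂ (bcL μ (U k)) φ) • U k

variable {μ}
variable {U : ι → X →ᵇ ℂ} {a : ι → ℝ} {l : ℝ}

lemma psiB_hasSum (hu : Orthonormal ℂ (fun k => bcL μ (U k))) (hUl : ∀ k x, ‖U k x‖ ≤ l)
    (hl : 0 ≤ l) (ha : Summable a) (ha0 : ∀ k, 0 ≤ a k) (φ : Lp ℂ 2 μ) :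
    HasSum (fun k => ((a k : ℂ) * inner ℂ (bcL μ (U k)) φ) • U k) (psiB μ U a φ) := by
  apply Summable.hasSum
  refine Summable.of_norm_bounded (g := fun k => a k * (‖φ‖ * l)) (ha.mul_right _) fun k => ?_
  rw [norm_smul, norm_mul, Complex.norm_real, Real.norm_of_nonneg (ha0 k), mul_assoc]
  have h1 : ‖inner ℂ (bcL μ (U k)) φ‖ ≤ ‖φ‖ := by
    have := norm_inner_le_norm (𝕜 := ℂ) (bcL μ (U k)) φ
    rwa [hu.1 k, one_mul] at this
  have h2 : ‖U k‖ ≤ l := (BoundedContinuousFunction.norm_le hl).2 (hUl k)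
  have := ha0 k
  gcongr

lemma psiB_hasSum_Lp (hu : Orthonormal ℂ (fun k => bcL μ (U k))) (hUl : ∀ k x, ‖U k x‖ ≤ l)
    (hl : 0 ≤ l) (ha : Summable a) (ha0 : ∀ k, 0 ≤ a k) (φ : Lp ℂ 2 μ) :
    HasSum (fun k => ((a k : ℂ) * inner ℂ (bcL μ (U k)) φ) • bcL μ (U k))
      (bcL μ (psiB μ U a φ)) := by
  have := (psiB_hasSum hu hUl hl ha ha0 φ).mapL (BoundedContinuousFunction.toLp 2 μ ℂ)
  simpa using this

lemma psiB_hasSum_pt (hu : Orthonormal ℂ (fun k => bcL μ (U k))) (hUl : ∀ k x, ‖U k x‖ ≤ l)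
    (hl : 0 ≤ l) (ha : Summable a) (ha0 : ∀ k, 0 ≤ a k) (φ : Lp ℂ 2 μ) (z : X) :
    HasSum (fun k => ((a k : ℂ) * inner ℂ (bcL μ (U k)) φ) * U k z)
      (psiB μ U a φ z) := by
  have := (psiB_hasSum hu hUl hl ha ha0 φ).mapL (BoundedContinuousFunction.evalCLM ℂ z)
  simpa using this

variable {H : X → X → ℂ}

lemma ker_apply [Countable ι] (hu : Orthonormal ℂ (fun k => bcL μ (U k)))
    (hUl : ∀ k x, ‖U k x‖ ≤ l)
    (hl : 0 ≤ l) (ha : Summable a) (ha0 : ∀ k, 0 ≤ a k)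
    (hH : ∀ x y, HasSum (fun k => (a k : ℂ) * (U k x * conj (U k y))) (H x y))
    (φ : Lp ℂ 2 μ) (z : X) :
    ∫ y, H z y * (φ : X → ℂ) y ∂μ = psiB μ U a φ z := by
  have hφ := Lp2_integrable μ φ
  have hFint : ∀ k, Integrable (fun y => (a k : ℂ) * (U k z * conj (U k y)) * (φ : X → ℂ) y) μ := by
    intro k
    refine hφ.bdd_mul (c := a k * (l * l)) ?_ (ae_of_all _ fun y => ?_)
    · have : Continuous (fun y => (a k : ℂ) * (U k z * conj (U k y))) := by fun_prop
      exact this.aestronglyMeasurable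
    · rw [norm_mul, norm_mul, Complex.norm_real, Real.norm_of_nonneg (ha0 k), RCLike.norm_conj]
      have := ha0 k
      gcongr
      · exact hUl k z
      · exact hUl k y
  have hsum : Summable fun k => ∫ y, ‖(a k : ℂ) * (U k z * conj (U k y)) * (φ : X → ℂ) y‖ ∂μ := by
    refine Summable.of_nonneg_of_le (fun k => integral_nonneg fun y => norm_nonneg _) (fun k => ?_)
      (ha.mul_right ((l * l) * ∫ y, ‖(φ : X → ℂ) y‖ ∂μ))
    rw [← mul_assoc, ← integral_const_mul]
    refine integral_mono (hFint k).norm (hφ.norm.const_mul _) fun y => ?_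
    beta_reduce
    rw [norm_mul, norm_mul, norm_mul, Complex.norm_real, Real.norm_of_nonneg (ha0 k),
      RCLike.norm_conj]
    have := ha0 k
    gcongr
    · exact hUl k z
    · exact hUl k y
  have h1 := hasSum_integral_of_summable_integral_norm hFint hsum
  have h2 : ∫ y, H z y * (φ : X → ℂ) y ∂μ =
      ∫ y, ∑' k, (a k : ℂ) * (U k z * conj (U k y)) * (φ : X → ℂ) y ∂μ := by
    refine integral_congr_ae (ae_of_all _ fun y => ?_)
    exact ((hH z y).mul_right _).tsum_eq.symm
  rw [h2]
  refine h1.unique ?_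
  convert! psiB_hasSum_pt hu hUl hl ha ha0 φ z using 2 with k
  rw [inner_bcL, mul_right_comm, ← integral_const_mul]
  refine integral_congr_ae (ae_of_all _ fun y => ?_)
  beta_reduce; ring

lemma ker_cont (hUl : ∀ k x, ‖U k x‖ ≤ l)
    (hl : 0 ≤ l) (ha : Summable a) (ha0 : ∀ k, 0 ≤ a k)
    (hH : ∀ x y, HasSum (fun k => (a k : ℂ) * (U k x * conj (U k y))) (H x y)) :
    Continuous (Function.uncurry H) ∧ ∃ C, ∀ x y, ‖H x y‖ ≤ C := by
  have hb : ∀ k x y, ‖(a k : ℂ) * (U k x * conj (U k y))‖ ≤ a k * (l * l) := by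
    intro k x y
    rw [norm_mul, norm_mul, Complex.norm_real, Real.norm_of_nonneg (ha0 k), RCLike.norm_conj]
    have := ha0 k
    gcongr
    · exact hUl k x
    · exact hUl k y
  constructor
  · have : Function.uncurry H = fun q : X × X =>
        ∑' k, (a k : ℂ) * (U k q.1 * conj (U k q.2)) := by
      ext q
      exact (hH q.1 q.2).tsum_eq.symm
    rw [this]
    refine continuous_tsum (u := fun k => a k * (l * l)) (fun k => by fun_prop)
      (ha.mul_right _) (fun k q => hb k _ _)
  · refine ⟨∑' k, a k * (l * l), fun x y => ?_⟩
    rw [← (hH x y).tsum_eq]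
    exact tsum_of_norm_bounded (ha.mul_right _).hasSum (fun k => hb k x y)

lemma ker_swap (hHc : Continuous (Function.uncurry H)) (hHb : ∃ C, ∀ x y, ‖H x y‖ ≤ C)
    {p q : X → ℂ} (hp : Integrable p μ) (hq : Integrable q μ) :
    ∫ x, p x * ∫ z, H x z * q z ∂μ ∂μ = ∫ z, (∫ x, p x * H x z ∂μ) * q z ∂μ := by
  obtain ⟨C, hC⟩ := hHb
  have hI : Integrable (Function.uncurry fun x z => p x * (H x z * q z)) (μ.prod μ) := by
    have h1 : Integrable (fun w : X × X => p w.1 * q w.2) (μ.prod μ) := hp.mul_prod hq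
    have h2 := h1.bdd_mul (c := C) hHc.aestronglyMeasurable (ae_of_all _ fun w => hC w.1 w.2)
    refine h2.congr (ae_of_all _ fun w => ?_)
    simp only [Function.uncurry]; ring
  have := integral_integral_swap hI
  simp only [← integral_const_mul, ← integral_mul_const]
  rw [this]
  refine integral_congr_ae (ae_of_all _ fun z => ?_)
  refine integral_congr_ae (ae_of_all _ fun x => ?_)
  beta_reduce; ring

lemma inner_tilde [Countable ι] (hu : Orthonormal ℂ (fun k => bcL μ (U k)))
    (hUl : ∀ k x, ‖U k x‖ ≤ l)
    (hl : 0 ≤ l) (ha : Summable a) (ha0 : ∀ k, 0 ≤ a k)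
    (hH : ∀ x y, HasSum (fun k => (a k : ℂ) * (U k x * conj (U k y))) (H x y))
    (m : X → ℝ) (hm : Continuous m) (hm0 : ∀ x, 0 ≤ m x) (hm1 : ∀ x, m x ≤ 1)
    (T : Lp ℂ 2 μ →L[ℂ] Lp ℂ 2 μ)
    (hT : IsKernelOfC μ T (fun x y => ∫ z, H x z * (m z : ℂ) * H z y ∂μ))
    (χ φ : Lp ℂ 2 μ) :
    inner ℂ χ (T φ) = ∫ z, (m z : ℂ) * (conj (psiB μ U a χ z) * psiB μ U a φ z) ∂μ := by
  obtain ⟨hHc, hHb⟩ := ker_cont hUl hl ha ha0 hH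
  have hφ := Lp2_integrable μ φ
  have hχ := Lp2_integrable μ χ
  have hmc : Continuous (fun z => (m z : ℂ)) := Complex.continuous_ofReal.comp hm
  have hmb : ∀ z, ‖(m z : ℂ)‖ ≤ 1 := fun z => by
    rw [Complex.norm_real, Real.norm_of_nonneg (hm0 z)]; exact hm1 z
  have hsymm : ∀ x y, conj (H x y) = H y x := by
    intro x y
    refine (((Complex.hasSum_conj').2 (hH x y)).unique ?_)
    convert! hH y x using 2 with k
    simp only [map_mul, Complex.conj_ofReal, Complex.conj_conj]
    ring
  -- first Fubini
  have s1 : ∀ x, ∫ y, (∫ z, H x z * (m z : ℂ) * H z y ∂μ) * (φ : X → ℂ) y ∂μ =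
      ∫ z, H x z * ((m z : ℂ) * psiB μ U a φ z) ∂μ := by
    intro x
    have hp : Integrable (fun z => H x z * (m z : ℂ)) μ := by
      obtain ⟨C, hC⟩ := hHb
      have hc1 : Continuous (fun z => H x z) := hHc.comp (by fun_prop : Continuous fun z => (x, z))
      refine (integrable_const (C * 1)).mono' (hc1.mul hmc).aestronglyMeasurable
        (ae_of_all _ fun z => ?_)
      rw [norm_mul]
      exact mul_le_mul (hC _ _) (hmb z) (norm_nonneg _) (le_trans (norm_nonneg _) (hC x z))
    rw [← ker_swap hHc hHb hp hφ]
    refine integral_congr_ae (ae_of_all _ fun z => ?_)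
    beta_reduce
    rw [ker_apply hu hUl hl ha ha0 hH φ z]; ring
  have hq : Integrable (fun z => (m z : ℂ) * psiB μ U a φ z) μ :=
    (bc_integrable μ _).bdd_mul (c := 1) hmc.aestronglyMeasurable (ae_of_all _ hmb)
  have hp : Integrable (fun x => conj ((χ : X → ℂ) x)) μ := by
    have := (Complex.conjLIE.toContinuousLinearEquiv : ℂ →L[ℝ] ℂ).integrable_comp hχ
    simpa using this
  have s2 := ker_swap hHc hHb hp hq
  have s3 : inner ℂ χ (T φ) = ∫ x, conj ((χ : X → ℂ) x) *
      ∫ z, H x z * ((m z : ℂ) * psiB μ U a φ z) ∂μ ∂μ := by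
    rw [L2.inner_def]
    refine integral_congr_ae ?_
    filter_upwards [hT φ] with x hx
    rw [hx, RCLike.inner_apply, s1 x, mul_comm]
  rw [s3, s2]
  refine integral_congr_ae (ae_of_all _ fun z => ?_)
  beta_reduce
  have s4 : ∫ x, conj ((χ : X → ℂ) x) * H x z ∂μ = conj (psiB μ U a χ z) := by
    rw [← ker_apply hu hUl hl ha ha0 hH χ z, ← integral_conj]
    refine integral_congr_ae (ae_of_all _ fun x => ?_)
    beta_reduce
    rw [map_mul, hsymm, mul_comm]
  rw [s4]; ring

lemma bc_weight_integrable (m : X → ℝ) (hm : Continuous m) (hm0 : ∀ x, 0 ≤ m x)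
    (hm1 : ∀ x, m x ≤ 1) (P : X →ᵇ ℂ) : Integrable (fun z => m z * ‖P z‖ ^ 2) μ := by
  refine (integrable_const (1 * ‖P‖ ^ 2)).mono' (by fun_prop) (ae_of_all _ fun z => ?_)
  rw [Real.norm_of_nonneg (mul_nonneg (hm0 z) (sq_nonneg _))]
  have := hm1 z
  have := P.norm_coe_le_norm z
  gcongr

lemma inner_tilde_le [Countable ι] (hu : Orthonormal ℂ (fun k => bcL μ (U k)))
    (hUl : ∀ k x, ‖U k x‖ ≤ l)
    (hl : 0 ≤ l) (ha : Summable a) (ha0 : ∀ k, 0 ≤ a k)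
    (hH : ∀ x y, HasSum (fun k => (a k : ℂ) * (U k x * conj (U k y))) (H x y))
    (m : X → ℝ) (hm : Continuous m) (hm0 : ∀ x, 0 ≤ m x) (hm1 : ∀ x, m x ≤ 1)
    (T : Lp ℂ 2 μ →L[ℂ] Lp ℂ 2 μ)
    (hT : IsKernelOfC μ T (fun x y => ∫ z, H x z * (m z : ℂ) * H z y ∂μ))
    (B : ℝ) (hB0 : 0 ≤ B)
    (hB : ∀ φ : Lp ℂ 2 μ, ‖φ‖ = 1 → ∫ z, m z * ‖psiB μ U a φ z‖ ^ 2 ∂μ ≤ B) :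
    ‖T‖ ≤ B := by
  refine opNorm_le_of_form T B hB0 fun χ φ hχ hφ => ?_
  rw [inner_tilde hu hUl hl ha ha0 hH m hm hm0 hm1 T hT]
  have i1 := bc_weight_integrable (μ := μ) m hm hm0 hm1 (psiB μ U a χ)
  have i2 := bc_weight_integrable (μ := μ) m hm hm0 hm1 (psiB μ U a φ)
  have := norm_integral_le_of_norm_le
    (f := fun z => (m z : ℂ) * (conj (psiB μ U a χ z) * psiB μ U a φ z))
    (((i1.add i2).const_mul (1 / 2))) (ae_of_all _ fun z => by
      simp only [Pi.add_apply]
      rw [norm_mul, norm_mul, Complex.norm_real, Real.norm_of_nonneg (hm0 z), RCLike.norm_conj]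
      nlinarith [mul_nonneg (hm0 z) (sq_nonneg (‖psiB μ U a χ z‖ - ‖psiB μ U a φ z‖))])
  refine this.trans ?_
  rw [integral_const_mul]
  simp only [Pi.add_apply]
  rw [integral_add i1 i2]
  linarith [hB χ hχ, hB φ hφ]

/-- Cauchy–Schwarz with weight `h`. -/
lemma weight_cs (h : X → ℝ) (hc : Continuous h) (h0 : ∀ x, 0 ≤ h x) (h1 : ∀ x, h x ≤ 1)
    (hb : X →ᵇ ℂ) (hbh : ∀ x, hb x = (h x : ℂ)) (P : X →ᵇ ℂ) :
    ‖inner ℂ (bcL μ hb) (bcL μ P)‖ ^ 2 ≤ (∫ z, h z ∂μ) * ∫ z, h z * ‖P z‖ ^ 2 ∂μ := by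
  have hs : ∀ x, ‖((Real.sqrt (h x) : ℝ) : ℂ)‖ ≤ 1 := fun x => by
    rw [Complex.norm_real, Real.norm_of_nonneg (Real.sqrt_nonneg _)]
    exact Real.sqrt_le_one.2 (h1 x)
  let s : X →ᵇ ℂ := BoundedContinuousFunction.ofNormedAddCommGroup
    (fun x => ((Real.sqrt (h x) : ℝ) : ℂ)) (by fun_prop) 1 hs
  have hsx : ∀ x, s x = ((Real.sqrt (h x) : ℝ) : ℂ) := fun x => rfl
  have e1 : inner ℂ (bcL μ hb) (bcL μ P) = inner ℂ (bcL μ s) (bcL μ (s * P)) := by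
    rw [inner_bcL_bcL, inner_bcL_bcL]
    refine integral_congr_ae (ae_of_all _ fun x => ?_)
    simp only [BoundedContinuousFunction.mul_apply, hsx, hbh, Complex.conj_ofReal]
    rw [← mul_assoc, ← Complex.ofReal_mul, Real.mul_self_sqrt (h0 x)]
  have e2 : ‖bcL μ s‖ ^ 2 = ∫ z, h z ∂μ := by
    rw [norm_bcL_sq]
    refine integral_congr_ae (ae_of_all _ fun x => ?_)
    simp only [hsx, Complex.norm_real, Real.norm_eq_abs, sq_abs, Real.sq_sqrt (h0 x)]
  have e3 : ‖bcL μ (s * P)‖ ^ 2 = ∫ z, h z * ‖P z‖ ^ 2 ∂μ := by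
    rw [norm_bcL_sq]
    refine integral_congr_ae (ae_of_all _ fun x => ?_)
    simp only [BoundedContinuousFunction.mul_apply, norm_mul, mul_pow, hsx, Complex.norm_real,
      Real.norm_eq_abs, sq_abs, Real.sq_sqrt (h0 x)]
  rw [e1, ← e2, ← e3, ← mul_pow]
  exact pow_le_pow_left₀ (norm_nonneg _) (norm_inner_le_norm _ _) 2

end abstractKernel

section concrete

open BoundedContinuousFunction ComplexConjugate

/-- normalisation `L^{-d/2}` -/
def lnorm (d : ℕ) (L : ℝ) : ℝ := (Real.sqrt (L ^ d))⁻¹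

lemma lnorm_pos (d : ℕ) {L : ℝ} (hL : 0 < L) : 0 < lnorm d L := by
  unfold lnorm; positivity

lemma lnorm_sq (d : ℕ) {L : ℝ} (hL : 0 < L) : lnorm d L ^ 2 = (L ^ d)⁻¹ := by
  unfold lnorm; rw [inv_pow, Real.sq_sqrt (by positivity)]

/-- the phase -/
def phs (d : ℕ) (L : ℝ) (k : Fin d → ℤ) (x : EuclideanSpace ℝ (Fin d)) : ℂ :=
  Complex.exp (Complex.I * ((2 * Real.pi * (∑ i, (k i : ℝ) * x i) / L : ℝ) : ℂ))

lemma phs_norm (d : ℕ) (L : ℝ) (k : Fin d → ℤ) (x : EuclideanSpace ℝ (Fin d)) :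
    ‖phs d L k x‖ = 1 := by
  unfold phs; rw [mul_comm]; exact Complex.norm_exp_ofReal_mul_I _

lemma phs_cont (d : ℕ) (L : ℝ) (k : Fin d → ℤ) : Continuous (phs d L k) := by
  unfold phs; fun_prop

/-- plane waves -/
def Uw (d : ℕ) (L : ℝ) (k : Fin d → ℤ) : EuclideanSpace ℝ (Fin d) →ᵇ ℂ :=
  BoundedContinuousFunction.ofNormedAddCommGroup (fun x => (lnorm d L : ℂ) * phs d L k x)
    (continuous_const.mul (phs_cont d L k)) |lnorm d L| (fun x => by
      rw [norm_mul, phs_norm, mul_one, Complex.norm_real, Real.norm_eq_abs])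

lemma Uw_apply (d : ℕ) (L : ℝ) (k : Fin d → ℤ) (x : EuclideanSpace ℝ (Fin d)) :
    Uw d L k x = (lnorm d L : ℂ) * phs d L k x := rfl

lemma Uw_norm (d : ℕ) {L : ℝ} (hL : 0 < L) (k : Fin d → ℤ) (x : EuclideanSpace ℝ (Fin d)) :
    ‖Uw d L k x‖ = lnorm d L := by
  rw [Uw_apply, norm_mul, phs_norm, mul_one, Complex.norm_real,
    Real.norm_of_nonneg (lnorm_pos d hL).le]

lemma phs_conj_mul (d : ℕ) (L : ℝ) (j k : Fin d → ℤ) (x : EuclideanSpace ℝ (Fin d)) :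
    conj (phs d L j x) * phs d L k x = phs d L (k - j) x := by
  unfold phs
  rw [← Complex.exp_conj, ← Complex.exp_add]
  congr 1
  simp only [map_mul, Complex.conj_I, Complex.conj_ofReal, Pi.sub_apply, Int.cast_sub, sub_mul,
    Finset.sum_sub_distrib]
  push_cast; ring

lemma phs_mul_conj (d : ℕ) (L : ℝ) (k : Fin d → ℤ) (x y : EuclideanSpace ℝ (Fin d)) :
    phs d L k x * conj (phs d L k y) =
      Complex.exp (Complex.I * ((2 * Real.pi * (∑ i, (k i : ℝ) * (x i - y i)) / L : ℝ) : ℂ)) := by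
  unfold phs
  rw [← Complex.exp_conj, ← Complex.exp_add]
  congr 1
  simp only [map_mul, Complex.conj_I, Complex.conj_ofReal, mul_sub, Finset.sum_sub_distrib]
  push_cast; ring

lemma box_eq (d : ℕ) (L : ℝ) : box d L = (@WithLp.ofLp 2 (Fin d → ℝ)) ⁻¹'
    (Set.pi Set.univ fun _ => Set.Icc (-(L / 2)) (L / 2)) := by
  ext x
  simp only [box, Set.mem_setOf_eq, abs_le, Set.mem_preimage, Set.mem_pi, Set.mem_univ,
    true_imp_iff, Set.mem_Icc]

lemma box_meas (d : ℕ) (L : ℝ) : MeasurableSet (box d L) := by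
  rw [box_eq]
  exact (PiLp.volume_preserving_ofLp (Fin d)).measurable
    (MeasurableSet.univ_pi fun i => measurableSet_Icc)

lemma box_vol (d : ℕ) {L : ℝ} (hL : 0 < L) : volume (box d L) = ENNReal.ofReal (L ^ d) := by
  rw [box_eq, (PiLp.volume_preserving_ofLp (Fin d)).measure_preimage
    (MeasurableSet.univ_pi fun i => measurableSet_Icc).nullMeasurableSet, volume_pi_pi]
  have : L / 2 - -(L / 2) = L := by ring
  simp only [Real.volume_Icc, this, Finset.prod_const, Finset.card_univ, Fintype.card_fin]
  rw [ENNReal.ofReal_pow hL.le]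

lemma one_dim_int {L : ℝ} (hL : 0 < L) (n : ℤ) :
    ∫ t in Set.Icc (-(L / 2)) (L / 2),
      Complex.exp (Complex.I * ((2 * Real.pi * ((n : ℝ) * t) / L : ℝ) : ℂ)) =
      if n = 0 then (L : ℂ) else 0 := by
  split_ifs with h
  · simp only [h, Int.cast_zero, zero_mul, mul_zero, zero_div, Complex.ofReal_zero,
      Complex.exp_zero]
    rw [setIntegral_const, measureReal_def, Real.volume_Icc,
      ENNReal.toReal_ofReal (by linarith)]
    simp
  · rw [integral_Icc_eq_integral_Ioc, ← intervalIntegral.integral_of_le (by linarith)]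
    have hc : (Complex.I * (2 * Real.pi * n / L : ℂ)) ≠ 0 := by
      have : (n : ℂ) ≠ 0 := by exact_mod_cast h
      have : (L : ℂ) ≠ 0 := by exact_mod_cast hL.ne'
      have : (Real.pi : ℂ) ≠ 0 := by exact_mod_cast Real.pi_ne_zero
      simp [*]
    have e := integral_exp_mul_complex (a := -(L / 2)) (b := L / 2) hc
    have e2 : ∀ t : ℝ, Complex.exp (Complex.I * ((2 * Real.pi * ((n : ℝ) * t) / L : ℝ) : ℂ)) =
        Complex.exp (Complex.I * (2 * Real.pi * n / L : ℂ) * t) := by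
      intro t; congr 1; push_cast; ring
    simp only [e2]
    rw [e, div_eq_zero_iff]
    left
    rw [sub_eq_zero, Complex.exp_eq_exp_iff_exists_int]
    refine ⟨n, ?_⟩
    have : (L : ℂ) ≠ 0 := by exact_mod_cast hL.ne'
    push_cast
    field_simp
    ring

lemma phs_int (d : ℕ) {L : ℝ} (hL : 0 < L) (n : Fin d → ℤ) :
    ∫ x in box d L, phs d L n x = if n = 0 then ((L ^ d : ℝ) : ℂ) else 0 := by
  have hmp := PiLp.volume_preserving_ofLp (Fin d)
  have e1 : ∫ x in box d L, phs d L n x =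
      ∫ y in (Set.pi Set.univ fun _ : Fin d => Set.Icc (-(L / 2)) (L / 2)),
        ∏ i, Complex.exp (Complex.I * ((2 * Real.pi * ((n i : ℝ) * y i) / L : ℝ) : ℂ)) := by
    rw [box_eq, ← hmp.setIntegral_preimage_emb
      (MeasurableEquiv.toLp 2 (Fin d → ℝ)).symm.measurableEmbedding]
    refine integral_congr_ae (ae_of_all _ fun x => ?_)
    beta_reduce
    rw [← Complex.exp_sum, phs]
    congr 1
    push_cast
    rw [← Finset.mul_sum, ← Finset.sum_div, ← Finset.mul_sum]
  rw [e1, volume_pi, Measure.restrict_pi_pi, integral_fintype_prod_eq_prod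
    (f := fun i t => Complex.exp (Complex.I * ((2 * Real.pi * ((n i : ℝ) * t) / L : ℝ) : ℂ)))]
  simp only [one_dim_int hL]
  split_ifs with h
  · simp [h]
  · obtain ⟨i, hi⟩ := Function.ne_iff.1 h
    exact Finset.prod_eq_zero (Finset.mem_univ i) (if_neg hi)

/-- the measure on the box -/
abbrev muB (d : ℕ) (L : ℝ) : Measure (EuclideanSpace ℝ (Fin d)) :=
  (volume : Measure (EuclideanSpace ℝ (Fin d))).restrict (box d L)

instance muB_finite (d : ℕ) (L : ℝ) : IsFiniteMeasure (muB d L) := by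
  refine ⟨?_⟩
  rw [Measure.restrict_apply_univ]
  rw [box_eq, (PiLp.volume_preserving_ofLp (Fin d)).measure_preimage
    (MeasurableSet.univ_pi fun i => measurableSet_Icc).nullMeasurableSet, volume_pi_pi]
  exact ENNReal.prod_lt_top fun i _ => by rw [Real.volume_Icc]; exact ENNReal.ofReal_lt_top

lemma Uw_orthonormal (d : ℕ) {L : ℝ} (hL : 0 < L) :
    Orthonormal ℂ (fun k => bcL (muB d L) (Uw d L k)) := by
  rw [orthonormal_iff_ite]
  intro j k
  rw [inner_bcL_bcL]
  have : ∀ y, conj (Uw d L j y) * Uw d L k y = ((lnorm d L ^ 2 : ℝ) : ℂ) * phs d L (k - j) y := by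
    intro y
    rw [Uw_apply, Uw_apply, ← phs_conj_mul, map_mul, Complex.conj_ofReal]
    push_cast; ring
  simp only [this]
  rw [integral_const_mul, phs_int d hL, lnorm_sq d hL]
  by_cases h : j = k
  · rw [if_pos (by rw [h, sub_self]), if_pos h, ← Complex.ofReal_mul,
      inv_mul_cancel₀ (by positivity)]
    simp
  · rw [if_neg (by rw [sub_eq_zero]; exact Ne.symm h), if_neg h, mul_zero]

/-- the eigenvalues of `G_L^{1/2}` -/
def aw (d : ℕ) (β L : ℝ) (k : Fin d → ℤ) : ℝ :=
  Real.exp (-(β / 2) * ∑ i, (2 * Real.pi * (k i : ℝ) / L) ^ 2)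

lemma aw_eq (d : ℕ) (β L : ℝ) (k : Fin d → ℤ) :
    aw d β L k = Real.exp (-(β / 2) * ‖latPt d L k‖ ^ 2) := by
  rw [aw, EuclideanSpace.norm_sq_eq]
  simp only [latPt, Real.norm_eq_abs, sq_abs]

lemma aw_sq (d : ℕ) (β L : ℝ) (k : Fin d → ℤ) :
    aw d β L k ^ 2 = Real.exp (-β * ‖latPt d L k‖ ^ 2) := by
  rw [aw_eq, ← Real.exp_nat_mul]; congr 1; push_cast; ring

lemma latPt_zero (d : ℕ) (L : ℝ) : latPt d L 0 = 0 := by ext i; simp [latPt]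

lemma latPt_norm (d : ℕ) {L : ℝ} (hL : 0 < L) (k : Fin d → ℤ) (hk : k ≠ 0) :
    (2 * Real.pi / L) ^ 2 ≤ ‖latPt d L k‖ ^ 2 := by
  obtain ⟨i, hi⟩ := Function.ne_iff.1 hk
  have h1 : (1:ℝ) ≤ (k i : ℝ) ^ 2 := by
    have : (1:ℤ) ≤ (k i) ^ 2 := by
      have := sq_nonneg (k i)
      have h3 : (k i)^2 ≠ 0 := pow_ne_zero _ hi
      omega
    exact_mod_cast this
  rw [EuclideanSpace.norm_sq_eq]
  calc (2 * Real.pi / L) ^ 2 ≤ (2 * Real.pi / L) ^ 2 * (k i : ℝ) ^ 2 :=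
        le_mul_of_one_le_right (by positivity) h1
    _ = ‖latPt d L k i‖ ^ 2 := by simp only [latPt, Real.norm_eq_abs, sq_abs]; ring
    _ ≤ _ := Finset.single_le_sum (f := fun i => ‖latPt d L k i‖ ^ 2)
        (fun i _ => sq_nonneg _) (Finset.mem_univ i)

lemma aw_summable (d : ℕ) (hd : 2 < d) {β : ℝ} (hβ : 0 < β) {L : ℝ} (hL : 0 < L) :
    Summable (aw d β L) := by
  have hb : Summable (fun k : Fin d → ℤ => boseR (β / 2) ‖latPt d L k‖) :=
    summable_of_sum_le (fun k => boseR_nonneg (by positivity) _)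
      (bose_sum_le d hd (half_pos hβ) hL)
  refine Summable.of_nonneg_of_le (fun k => Real.exp_nonneg _) (fun k => ?_)
    (hb.add (hasSum_ite_eq (0 : Fin d → ℤ) (1 : ℝ)).summable)
  by_cases hk0 : k = 0
  · have := boseR_nonneg (half_pos hβ) ‖latPt d L k‖
    rw [if_pos hk0, aw_eq, hk0, latPt_zero, norm_zero, boseR_zero]
    simp
  rw [if_neg hk0, add_zero]
  simp only [boseR, aw_eq]
  have hpos : 0 < ‖latPt d L k‖ ^ 2 :=
    lt_of_lt_of_le (by have := Real.pi_pos; positivity) (latPt_norm d hL k hk0)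
  have h1 : Real.exp (-(β / 2) * ‖latPt d L k‖ ^ 2) < 1 := by
    apply Real.exp_lt_one_iff.2
    have : 0 < (β / 2) * ‖latPt d L k‖ ^ 2 := by positivity
    linarith
  have h2 := Real.exp_pos (-(β / 2) * ‖latPt d L k‖ ^ 2)
  rw [le_div_iff₀ (by linarith)]
  nlinarith

lemma aw_pos (d : ℕ) (β L : ℝ) (k : Fin d → ℤ) : 0 ≤ aw d β L k := Real.exp_nonneg _

lemma aw_zero (d : ℕ) (β L : ℝ) : aw d β L 0 = 1 := by simp [aw]

lemma heat_hasSum (d : ℕ) (hd : 2 < d) {β : ℝ} (hβ : 0 < β) {L : ℝ} (hL : 0 < L)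
    (x y : EuclideanSpace ℝ (Fin d)) :
    HasSum (fun k => (aw d β L k : ℂ) * (Uw d L k x * conj (Uw d L k y)))
      (heatHalfKer d β L x y) := by
  have e : ∀ k : Fin d → ℤ, (aw d β L k : ℂ) * (Uw d L k x * conj (Uw d L k y)) =
      Complex.exp (((-(β / 2) * ∑ i, (2 * Real.pi * (k i : ℝ) / L) ^ 2 : ℝ) : ℂ) +
        Complex.I * ((2 * Real.pi * (∑ i, (k i : ℝ) * (x i - y i)) / L : ℝ) : ℂ)) / (L : ℂ) ^ d := by
    intro k
    rw [Complex.exp_add, ← phs_mul_conj, ← Complex.ofReal_exp, Uw_apply, Uw_apply, map_mul,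
      Complex.conj_ofReal, div_eq_mul_inv, ← Complex.ofReal_pow, ← Complex.ofReal_inv,
      ← lnorm_sq d hL, aw]
    push_cast; ring
  have hs : Summable (fun k => (aw d β L k : ℂ) * (Uw d L k x * conj (Uw d L k y))) := by
    refine Summable.of_norm_bounded ((aw_summable d hd hβ hL).mul_right (lnorm d L * lnorm d L))
      fun k => ?_
    rw [norm_mul, norm_mul, RCLike.norm_conj, Uw_norm d hL, Uw_norm d hL, Complex.norm_real,
      Real.norm_of_nonneg (aw_pos d β L k)]
  have := hs.hasSum
  unfold heatHalfKer
  rw [← tsum_div_const]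
  simp only [e] at this ⊢
  exact this

end concrete

section assembly

open BoundedContinuousFunction ComplexConjugate

variable {d : ℕ} {β L : ℝ} {f : EuclideanSpace ℝ (Fin d) → ℝ}

/-- bounded continuous version of `1 - e^{-f}` -/
lemma hB_exists (hfc : Continuous f) (hf0 : ∀ x, 0 ≤ f x) :
    ∃ hb : EuclideanSpace ℝ (Fin d) →ᵇ ℂ, ∀ x, hb x = ((1 - Real.exp (-f x) : ℝ) : ℂ) := by
  refine ⟨BoundedContinuousFunction.ofNormedAddCommGroup
    (fun x => ((1 - Real.exp (-f x) : ℝ) : ℂ)) (by fun_prop) 1 (fun x => ?_), fun x => rfl⟩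
  have h1 : Real.exp (-f x) ≤ 1 := Real.exp_le_one_iff.2 (by linarith [hf0 x])
  have h2 := Real.exp_pos (-f x)
  rw [Complex.norm_real, Real.norm_of_nonneg (by linarith)]
  linarith

lemma weight_split (hfc : Continuous f) (hf0 : ∀ x, 0 ≤ f x) (P : EuclideanSpace ℝ (Fin d) →ᵇ ℂ) :
    ∫ z, Real.exp (-f z) * ‖P z‖ ^ 2 ∂(muB d L) =
      ‖bcL (muB d L) P‖ ^ 2 - ∫ z, (1 - Real.exp (-f z)) * ‖P z‖ ^ 2 ∂(muB d L) := by
  have h1 : ∀ x, Real.exp (-f x) ≤ 1 := fun x => Real.exp_le_one_iff.2 (by linarith [hf0 x])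
  have h2 := fun x => Real.exp_pos (-f x)
  have i1 : Integrable (fun z => (1 - Real.exp (-f z)) * ‖P z‖ ^ 2) (muB d L) :=
    bc_weight_integrable (fun z => 1 - Real.exp (-f z)) (by fun_prop)
      (fun x => by linarith [h1 x]) (fun x => by linarith [h2 x]) P
  have i2 : Integrable (fun z => (1 : ℝ) * ‖P z‖ ^ 2) (muB d L) :=
    bc_weight_integrable (fun z => 1) (by fun_prop) (fun x => zero_le_one) (fun x => le_rfl) P
  rw [norm_bcL_sq]
  simp only [one_mul] at i2
  rw [← integral_sub i2 i1]
  refine integral_congr_ae (ae_of_all _ fun z => ?_)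
  beta_reduce; ring

lemma norm_Gt_le_one (hd : 2 < d) (hβ : 0 < β) (hfc : Continuous f) (hf0 : ∀ x, 0 ≤ f x)
    (hL : 0 < L) (T : Lp ℂ 2 (muB d L) →L[ℂ] Lp ℂ 2 (muB d L))
    (hT : IsKernelOfC (muB d L) T (tildeGKer d β L f)) : ‖T‖ ≤ 1 := by
  have h1 : ∀ x, Real.exp (-f x) ≤ 1 := fun x => Real.exp_le_one_iff.2 (by linarith [hf0 x])
  have h2 := fun x => Real.exp_pos (-f x)
  have hu := Uw_orthonormal d hL
  have hUl : ∀ k x, ‖Uw d L k x‖ ≤ lnorm d L := fun k x => (Uw_norm d hL k x).le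
  refine inner_tilde_le hu hUl (lnorm_pos d hL).le (aw_summable d hd hβ hL) (aw_pos d β L)
    (heat_hasSum d hd hβ hL) (fun z => Real.exp (-f z)) (by fun_prop) (fun x => (h2 x).le) h1 T hT
    1 zero_le_one fun φ hφ => ?_
  rw [weight_split hfc hf0]
  have hS := hilb_hasSum_sq hu _ _ (psiB_hasSum_Lp hu hUl (lnorm_pos d hL).le
    (aw_summable d hd hβ hL) (aw_pos d β L) φ)
  have hle : ‖bcL (muB d L) (psiB (muB d L) (Uw d L) (aw d β L) φ)‖ ^ 2 ≤ ‖φ‖ ^ 2 := by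
    refine le_of_tendsto hS (Eventually.of_forall fun F => ?_)
    refine le_trans (Finset.sum_le_sum fun k _ => ?_) (hu.sum_inner_products_le φ (s := F))
    gcongr
    rw [norm_mul, Complex.norm_real, Real.norm_of_nonneg (aw_pos d β L k)]
    refine mul_le_of_le_one_left (norm_nonneg _) ?_
    rw [aw_eq]
    apply Real.exp_le_one_iff.2
    have : 0 ≤ (β / 2) * ‖latPt d L k‖ ^ 2 := by positivity
    linarith
  have hQ : 0 ≤ ∫ z, (1 - Real.exp (-f z)) *
      ‖psiB (muB d L) (Uw d L) (aw d β L) φ z‖ ^ 2 ∂(muB d L) :=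
    integral_nonneg fun z => mul_nonneg (by linarith [h1 z]) (sq_nonneg _)
  rw [hφ] at hle
  linarith

/-- the spectral gap of the free problem -/
def gapL (β L : ℝ) : ℝ := 1 - Real.exp (-β * (2 * Real.pi / L) ^ 2)

lemma gapL_pos (hβ : 0 < β) (hL : 0 < L) : 0 < gapL β L := by
  unfold gapL
  have : Real.exp (-β * (2 * Real.pi / L) ^ 2) < 1 := by
    apply Real.exp_lt_one_iff.2
    have : 0 < β * (2 * Real.pi / L) ^ 2 := by have := Real.pi_pos; positivity
    linarith
  linarith

/-- the finite-volume critical density (as an integral of a step function) -/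
def rhoL (d : ℕ) (β L : ℝ) : ℝ := (∫ p, boseStep d β L p) / (2 * Real.pi) ^ d

lemma norm_Gt_le (hd : 2 < d) (hβ : 0 < β) (hfc : Continuous f) (hf0 : ∀ x, 0 ≤ f x)
    (hL : 0 < L) (T : Lp ℂ 2 (muB d L) →L[ℂ] Lp ℂ 2 (muB d L))
    (hT : IsKernelOfC (muB d L) T (tildeGKer d β L f)) (N : ℝ) (hN : 0 < N)
    (hNi : ∫ z, (1 - Real.exp (-f z)) ∂(muB d L) = N) :
    ((gapL β L * L ^ d)⁻¹ + (1 + N * rhoL d β L) / N)⁻¹ ≤ L ^ d * (1 - ‖T‖) := by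
  have h1 : ∀ x, Real.exp (-f x) ≤ 1 := fun x => Real.exp_le_one_iff.2 (by linarith [hf0 x])
  have h2 := fun x => Real.exp_pos (-f x)
  have hu := Uw_orthonormal d hL
  have hl := lnorm_pos d hL
  have hUl : ∀ k x, ‖Uw d L k x‖ ≤ lnorm d L := fun k x => (Uw_norm d hL k x).le
  have hg := gapL_pos hβ hL
  have hg1 : gapL β L ≤ 1 := by unfold gapL; linarith [Real.exp_pos (-β * (2 * Real.pi / L) ^ 2)]
  obtain ⟨hb, hbx⟩ := hB_exists hfc hf0
  have hpi := Real.pi_pos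
  have hLd : 0 < L ^ d := by positivity
  have hrho : 0 ≤ rhoL d β L := by
    unfold rhoL
    exact div_nonneg (integral_nonneg fun p => boseR_nonneg hβ _) (by positivity)
  set V : ℝ := ((gapL β L * L ^ d)⁻¹ + (1 + N * rhoL d β L) / N)⁻¹ with hV
  have hVpos : 0 < V := by positivity
  -- the key lower bound
  have key : ∀ φ : Lp ℂ 2 (muB d L), ‖φ‖ = 1 →
      ∫ z, Real.exp (-f z) * ‖psiB (muB d L) (Uw d L) (aw d β L) φ z‖ ^ 2 ∂(muB d L) ≤
        1 - V / L ^ d := by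
    intro φ hφ
    rw [weight_split hfc hf0]
    set P := psiB (muB d L) (Uw d L) (aw d β L) φ with hP
    set Q := ∫ z, (1 - Real.exp (-f z)) * ‖P z‖ ^ 2 ∂(muB d L) with hQd
    have hQ : 0 ≤ Q :=
      integral_nonneg fun z => mul_nonneg (by linarith [h1 z]) (sq_nonneg _)
    have hw : ∀ k, inner ℂ (bcL (muB d L) hb) (bcL (muB d L) (Uw d L k)) =
        ∫ z, ((1 - Real.exp (-f z) : ℝ) : ℂ) * Uw d L k z ∂(muB d L) := by
      intro k
      rw [inner_bcL_bcL]
      simp only [hbx, Complex.conj_ofReal]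
    have hcs := weight_cs (μ := muB d L) (fun z => 1 - Real.exp (-f z)) (by fun_prop)
      (fun x => by linarith [h1 x]) (fun x => by linarith [h2 x]) hb hbx P
    rw [hNi] at hcs
    have hm := hilb_main hu (aw d β L) 0 (aw_zero d β L) (gapL β L) hg hg1
      (fun k hk => by
        rw [aw_sq, gapL, sub_sub_cancel]
        apply Real.exp_le_exp.2
        have := mul_le_mul_of_nonneg_left (latPt_norm d hL k hk) hβ.le
        linarith)
      ((∫ p, boseStep d β L p) / (2 * Real.pi / L) ^ d)
      (fun F _ => by
        refine le_trans (le_of_eq ?_) (bose_sum_le d hd hβ hL F)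
        refine Finset.sum_congr rfl fun k _ => ?_
        rw [aw_sq, boseR])
      (innerSL ℂ (bcL (muB d L) hb)) N (lnorm d L) hN hl
      (fun k => by
        rw [innerSL_apply_apply, hw]
        refine (norm_integral_le_integral_norm _).trans (le_of_eq ?_)
        rw [← hNi, ← integral_mul_const]
        refine integral_congr_ae (ae_of_all _ fun z => ?_)
        beta_reduce
        rw [norm_mul, Uw_norm d hL, Complex.norm_real, Real.norm_of_nonneg (by linarith [h1 z])])
      (by
        rw [innerSL_apply_apply, hw]
        have : ∀ z, ((1 - Real.exp (-f z) : ℝ) : ℂ) * Uw d L 0 z =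
            (((1 - Real.exp (-f z)) * lnorm d L : ℝ) : ℂ) := by
          intro z
          rw [Uw_apply]
          simp [phs]
        simp only [this]
        rw [integral_complex_ofReal, integral_mul_const, hNi, Complex.norm_real,
          Real.norm_of_nonneg (by positivity)])
      φ (bcL (muB d L) P)
      (psiB_hasSum_Lp hu hUl hl.le (aw_summable d hd hβ hL) (aw_pos d β L) φ) Q hQ
      (by rw [innerSL_apply_apply]; exact hcs)
    obtain ⟨m1, m2⟩ := hm
    have hR : lnorm d L ^ 2 * ((∫ p, boseStep d β L p) / (2 * Real.pi / L) ^ d) = rhoL d β L := by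
      rw [lnorm_sq d hL, rhoL, div_pow]
      field_simp
    rw [hR, lnorm_sq d hL] at m2
    rw [hφ] at m1 m2
    set c2 := ‖inner ℂ (bcL (muB d L) (Uw d L 0)) φ‖ ^ 2
    set D := (1:ℝ) ^ 2 - ‖bcL (muB d L) P‖ ^ 2 + Q with hD
    have g1 : 1 - c2 ≤ (gapL β L * L ^ d)⁻¹ * (D * L ^ d) := by
      rw [mul_inv]
      have : (gapL β L)⁻¹ * (L ^ d)⁻¹ * (D * L ^ d) = D / gapL β L := by field_simp
      rw [this, le_div_iff₀ hg]; linarith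
    have g2 : c2 ≤ (1 + N * rhoL d β L) / N * (D * L ^ d) := by
      have e : (1 + N * rhoL d β L) / N * (D * L ^ d) =
        ((1 + N * rhoL d β L) * D) / (N * (L ^ d)⁻¹) := by field_simp
      rw [e, le_div_iff₀ (by positivity)]
      exact m2
    have g3 : V ≤ D * L ^ d := by
      rw [hV, inv_le_iff_one_le_mul₀ (by positivity)]
      linarith
    have g4 : V / L ^ d ≤ D := by
      rw [div_le_iff₀ hLd]; exact g3
    rw [hD] at g4
    linarith
  -- conclude
  have hB0 : 0 ≤ 1 - V / L ^ d := by
    have hne : ∃ φ : Lp ℂ 2 (muB d L), ‖φ‖ = 1 := ⟨bcL (muB d L) (Uw d L 0), hu.1 0⟩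
    obtain ⟨φ, hφ⟩ := hne
    exact le_trans (integral_nonneg fun z => mul_nonneg (h2 z).le (sq_nonneg _)) (key φ hφ)
  have := inner_tilde_le hu hUl hl.le (aw_summable d hd hβ hL) (aw_pos d β L)
    (heat_hasSum d hd hβ hL) (fun z => Real.exp (-f z)) (by fun_prop) (fun x => (h2 x).le) h1 T hT
    _ hB0 key
  have h5 : V / L ^ d ≤ 1 - ‖T‖ := by linarith
  rw [div_le_iff₀ hLd] at h5
  linarith

lemma norm_Gt_ge (hd : 2 < d) (hβ : 0 < β) (hfc : Continuous f) (hf0 : ∀ x, 0 ≤ f x)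
    (hL : 0 < L) (T : Lp ℂ 2 (muB d L) →L[ℂ] Lp ℂ 2 (muB d L))
    (hT : IsKernelOfC (muB d L) T (tildeGKer d β L f)) :
    L ^ d * (1 - ‖T‖) ≤ ∫ z, (1 - Real.exp (-f z)) ∂(muB d L) := by
  have h1 : ∀ x, Real.exp (-f x) ≤ 1 := fun x => Real.exp_le_one_iff.2 (by linarith [hf0 x])
  have h2 := fun x => Real.exp_pos (-f x)
  have hu := Uw_orthonormal d hL
  have hl := lnorm_pos d hL
  have hLd : 0 < L ^ d := by positivity
  have hUl : ∀ k x, ‖Uw d L k x‖ ≤ lnorm d L := fun k x => (Uw_norm d hL k x).le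
  set φ := bcL (muB d L) (Uw d L 0) with hφ
  have hφ1 : ‖φ‖ = 1 := hu.1 0
  have hpsi : psiB (muB d L) (Uw d L) (aw d β L) φ = Uw d L 0 := by
    refine (psiB_hasSum hu hUl hl.le (aw_summable d hd hβ hL) (aw_pos d β L) φ).unique ?_
    convert! hasSum_ite_eq (0 : Fin d → ℤ) (Uw d L 0) using 2 with k
    rw [hφ, orthonormal_iff_ite.1 hu k 0]
    by_cases hk : k = 0
    · simp [hk, aw_zero]
    · simp [hk]
  have hin := inner_tilde hu hUl hl.le (aw_summable d hd hβ hL) (aw_pos d β L)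
    (heat_hasSum d hd hβ hL) (fun z => Real.exp (-f z)) (by fun_prop) (fun x => (h2 x).le) h1 T hT
    φ φ
  rw [hpsi] at hin
  have e1 : ∫ z, ((Real.exp (-f z) : ℝ) : ℂ) * (conj (Uw d L 0 z) * Uw d L 0 z) ∂(muB d L) =
      ((∫ z, Real.exp (-f z) * ‖Uw d L 0 z‖ ^ 2 ∂(muB d L) : ℝ) : ℂ) := by
    rw [← integral_complex_ofReal]
    refine integral_congr_ae (ae_of_all _ fun z => ?_)
    beta_reduce
    rw [RCLike.conj_mul]
    push_cast
    rfl
  rw [e1, weight_split hfc hf0] at hin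
  change inner ℂ φ (T φ) = (((‖φ‖ ^ 2 - _ : ℝ)) : ℂ) at hin
  have hle : ‖inner ℂ φ (T φ)‖ ≤ ‖T‖ := by
    refine (norm_inner_le_norm _ _).trans ?_
    have := T.le_opNorm φ
    rw [hφ1] at this ⊢
    linarith
  rw [hin, Complex.norm_real, hφ1] at hle
  have hle2 := (le_abs_self _).trans hle
  have e2 : ∫ z, (1 - Real.exp (-f z)) * ‖Uw d L 0 z‖ ^ 2 ∂(muB d L) =
      (∫ z, (1 - Real.exp (-f z)) ∂(muB d L)) * (L ^ d)⁻¹ := by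
    rw [← integral_mul_const]
    refine integral_congr_ae (ae_of_all _ fun z => ?_)
    beta_reduce
    rw [Uw_norm d hL, lnorm_sq d hL]
  rw [e2] at hle2
  have h6 : 1 - ‖T‖ ≤ (∫ z, (1 - Real.exp (-f z)) ∂(muB d L)) * (L ^ d)⁻¹ := by linarith
  rw [← div_eq_mul_inv, le_div_iff₀ hLd] at h6
  linarith

lemma N_eventually (hfs : HasCompactSupport f) :
    ∀ᶠ L : ℝ in atTop, ∫ z, (1 - Real.exp (-f z)) ∂(muB d L) = ∫ z, (1 - Real.exp (-f z)) := by
  obtain ⟨r, hr⟩ := hfs.isCompact.isBounded.subset_closedBall 0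
  filter_upwards [eventually_ge_atTop (2 * r)] with L hL
  apply setIntegral_eq_integral_of_forall_compl_eq_zero
  intro x hx
  have : f x = 0 := by
    by_contra h
    apply hx
    have h1 := hr (subset_tsupport f h)
    rw [mem_closedBall_zero_iff] at h1
    intro i
    have h3 := PiLp.norm_apply_le x i
    rw [Real.norm_eq_abs] at h3
    linarith
  simp [this]

lemma gap_tendsto (hd : 2 < d) (hβ : 0 < β) :
    Tendsto (fun L : ℝ => (gapL β L * L ^ d)⁻¹) atTop (nhds 0) := by
  have hpi := Real.pi_pos
  set c := β * (2 * Real.pi) ^ 2 with hc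
  have hc0 : 0 < c := by positivity
  have hz : Tendsto (fun L : ℝ => ((1 + c) / c) / L) atTop (nhds 0) :=
    tendsto_const_nhds.div_atTop tendsto_id
  refine squeeze_zero' ?_ ?_ hz
  · filter_upwards [eventually_gt_atTop 0] with L hL
    have := gapL_pos hβ hL
    positivity
  · filter_upwards [eventually_ge_atTop 1] with L hL
    have hL0 : 0 < L := by linarith
    have hg : c / (L ^ 2 + c) ≤ gapL β L := by
      unfold gapL
      have e : -β * (2 * Real.pi / L) ^ 2 = -(c / L ^ 2) := by rw [hc]; field_simp
      rw [e, Real.exp_neg]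
      have h1 := Real.add_one_le_exp (c / L ^ 2)
      have h2 : (Real.exp (c / L ^ 2))⁻¹ ≤ (c / L ^ 2 + 1)⁻¹ :=
        inv_anti₀ (by positivity) h1
      have h3 : (c / L ^ 2 + 1)⁻¹ = 1 - c / (L ^ 2 + c) := by field_simp; ring
      linarith
    have h4 : c / (L ^ 2 + c) * L ^ 3 ≤ gapL β L * L ^ d := by
      apply mul_le_mul hg (pow_le_pow_right₀ hL hd) (by positivity) (gapL_pos hβ hL0).le
    calc (gapL β L * L ^ d)⁻¹ ≤ (c / (L ^ 2 + c) * L ^ 3)⁻¹ := inv_anti₀ (by positivity) h4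
      _ ≤ (c / (L ^ 2 + c * L ^ 2) * L ^ 3)⁻¹ := by
          apply inv_anti₀ (by positivity)
          gcongr
          exact le_mul_of_one_le_right hc0.le (one_le_pow₀ hL)
      _ = _ := by field_simp

end assembly

/-- Lemma 6(iii): with `g̃₀(L) = ‖G̃_L‖` the largest eigenvalue of
`G̃_L = G_L^{1/2}e^{-f}G_L^{1/2}` and `g₀(L) = 1`, one has, for all sufficiently
large `L`, `L^d(g₀(L) - g̃₀(L)) ≤ ‖1-e^{-f}‖₁`, and for every `ε > 0`,
eventually `L^d(g₀(L) - g̃₀(L)) ≥ ‖1-e^{-f}‖₁/(1+ρ_c‖1-e^{-f}‖₁) - ε`. -/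
theorem eigenvalue_gap_bounds (d : ℕ) (hd : 2 < d) (β : ℝ) (hβ : 0 < β)
    (f : EuclideanSpace ℝ (Fin d) → ℝ) (hfc : Continuous f)
    (hfs : HasCompactSupport f) (hf0 : ∀ x, 0 ≤ f x)
    (Gt : ∀ L : ℝ,
      Lp ℂ 2 ((volume : Measure (EuclideanSpace ℝ (Fin d))).restrict (box d L)) →L[ℂ]
        Lp ℂ 2 ((volume : Measure (EuclideanSpace ℝ (Fin d))).restrict (box d L)))
    (hGtsa : ∀ L, IsSelfAdjoint (Gt L))
    (hGtker : ∀ L,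
      IsKernelOfC ((volume : Measure (EuclideanSpace ℝ (Fin d))).restrict (box d L)) (Gt L)
        (tildeGKer d β L f)) :
    (∀ᶠ L : ℝ in atTop,
      L ^ d * (1 - ‖Gt L‖) ≤ ∫ x : EuclideanSpace ℝ (Fin d), (1 - Real.exp (-f x))) ∧
    (∀ ε : ℝ, 0 < ε → ∀ᶠ L : ℝ in atTop,
      (∫ x : EuclideanSpace ℝ (Fin d), (1 - Real.exp (-f x))) /
          (1 + ((∫ p : EuclideanSpace ℝ (Fin d),
              Real.exp (-β * ‖p‖ ^ 2) / (1 - Real.exp (-β * ‖p‖ ^ 2))) / (2 * Real.pi) ^ d) *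
            (∫ x : EuclideanSpace ℝ (Fin d), (1 - Real.exp (-f x)))) - ε
        ≤ L ^ d * (1 - ‖Gt L‖)) := by
  constructor
  · filter_upwards [N_eventually hfs, eventually_gt_atTop 0] with L hNL hL
    rw [← hNL]
    exact norm_Gt_ge hd hβ hfc hf0 hL (Gt L) (hGtker L)
  · intro ε hε
    have hN0 : 0 ≤ ∫ x : EuclideanSpace ℝ (Fin d), (1 - Real.exp (-f x)) := by
      refine integral_nonneg fun x => ?_
      have : Real.exp (-f x) ≤ 1 := Real.exp_le_one_iff.2 (by linarith [hf0 x])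
      simpa using this
    generalize hN : (∫ x : EuclideanSpace ℝ (Fin d), (1 - Real.exp (-f x))) = N at hN0 ⊢
    rcases hN0.eq_or_lt with h0 | hpos
    · filter_upwards [eventually_gt_atTop 0] with L hL
      have h1 := norm_Gt_le_one hd hβ hfc hf0 hL (Gt L) (hGtker L)
      rw [← h0, zero_div]
      have : 0 ≤ L ^ d * (1 - ‖Gt L‖) := mul_nonneg (by positivity) (by linarith)
      linarith
    · have hpi := Real.pi_pos
      have hrho := (boseStep_tendsto d hd hβ).div_const ((2 * Real.pi) ^ d)
      have hρ0 : 0 ≤ (∫ p : EuclideanSpace ℝ (Fin d), boseR β ‖p‖) / (2 * Real.pi) ^ d :=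
        div_nonneg (integral_nonneg fun p => boseR_nonneg hβ _) (by positivity)
      change ∀ᶠ L : ℝ in atTop, N / (1 + ((∫ p : EuclideanSpace ℝ (Fin d), boseR β ‖p‖) /
        (2 * Real.pi) ^ d) * N) - ε ≤ L ^ d * (1 - ‖Gt L‖)
      generalize (∫ p : EuclideanSpace ℝ (Fin d), boseR β ‖p‖) / (2 * Real.pi) ^ d = ρ
        at hrho hρ0 ⊢
      have ht : Tendsto (fun L : ℝ => ((gapL β L * L ^ d)⁻¹ + (1 + N * rhoL d β L) / N)⁻¹) atTop
          (nhds ((0 + (1 + N * ρ) / N)⁻¹)) := by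
        refine ((gap_tendsto hd hβ).add ?_).inv₀ (by positivity)
        exact ((hrho.const_mul N).const_add 1).div_const N
      have he : (0 + (1 + N * ρ) / N)⁻¹ = N / (1 + ρ * N) := by
        rw [zero_add, inv_div, mul_comm N ρ]
      rw [he] at ht
      filter_upwards [ht.eventually_const_le (u := N / (1 + ρ * N) - ε) (by linarith),
        N_eventually hfs, eventually_gt_atTop 0] with L h1 h2 hL
      exact h1.trans (norm_Gt_le hd hβ hfc hf0 hL (Gt L) (hGtker L) N hpos (h2.trans hN))
end
end
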